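/- arXiv:1007.1782 — 9 statements merged into one kernel-verified Lean document; each statement's English description precedes it below -/
import Mathlib

section
/- Let n ≥ 2 be an integer, let K ⊆ ℝ^n be a compact set with K + ℤ^n = ℝ^n, and let l_1, …, l_n ⊆ ℝ^n be n one-dimensional linear subspaces spanned by n linearly independent vectors. Then (K − K) ∩ ℤ^n is not contained in l_1 ∪ l_2 ∪ … ∪ l_n. -/
open Pointwise

/-- A continuous self-map of the complex plane at bounded distance from the identity has a zero. -/
theorem Complex.exists_eq_zero_of_norm_sub_le {g : ℂ → ℂ} (hg : Continuous g) {B : ℝ}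
    (hB : ∀ w, ‖g w - w‖ ≤ B) : ∃ w, g w = 0 := by
  by_contra! h0
  have hcontr : ContractibleSpace (Set.univ : Set ℂ) :=
    convex_univ.contractibleSpace Set.univ_nonempty
  obtain ⟨L, hLc, hL⟩ := Complex.exists_continuousOn_eqOn_exp_comp
    (SimplyConnectedSpace.ofContractible (Set.univ : Set ℂ)) isOpen_univ hg.continuousOn
    (by simpa using h0)
  replace hLc : Continuous L := continuousOn_univ.1 hLc
  replace hL (w : ℂ) : Complex.exp (L w) = g w := hL (Set.mem_univ w)
  have hB0 : 0 ≤ B := (norm_nonneg _).trans (hB 0)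
  set R : ℝ := B + 1 with hR
  have hR0 : 0 < R := by positivity
  let γ : ℝ → ℂ := fun θ ↦ R * Complex.exp (θ * Complex.I)
  have hγc : Continuous γ := by fun_prop
  have hγ0 (θ : ℝ) : γ θ ≠ 0 := by simp [γ, hR0.ne']
  have hγn (θ : ℝ) : ‖γ θ‖ = R := by simp [γ, Complex.norm_exp_ofReal_mul_I, abs_of_pos hR0]
  have hslit (θ : ℝ) : g (γ θ) / γ θ ∈ Complex.slitPlane := by
    have hlt : ‖g (γ θ) / γ θ - 1‖ < 1 := by
      rw [div_sub_one (hγ0 θ), norm_div, hγn, div_lt_one hR0]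
      exact (hB _).trans_lt (by linarith)
    simpa using Complex.mem_slitPlane_of_norm_lt_one hlt
  let D : ℝ → ℂ := fun θ ↦ L (γ θ) - Complex.log (g (γ θ) / γ θ) - θ * Complex.I
  have hDc : Continuous D := by
    have : Continuous fun θ ↦ Complex.log (g (γ θ) / γ θ) :=
      ((hg.comp hγc).div hγc hγ0).clog hslit
    fun_prop
  have hD (θ : ℝ) : Complex.exp (D θ) = R := by
    have h1 := h0 (γ θ)
    have h2 := hγ0 θ
    simp only [D, Complex.exp_sub, hL, Complex.exp_log (div_ne_zero h1 h2)]
    rw [div_div_cancel₀ h1]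
    simp [γ]
  have hγ2 : γ (2 * Real.pi) = γ 0 := by simp [γ]
  have hconst := Complex.isCoveringMap_exp.const_of_comp hDc
    (fun a b ↦ Subtype.ext ((hD a).trans (hD b).symm)) (2 * Real.pi) 0
  simp [D, hγ2] at hconst

theorem isClosedEmbedding_pi_intCast (ι : Type*) :
    Topology.IsClosedEmbedding fun (z : ι → ℤ) (i : ι) ↦ (z i : ℝ) :=
  .piMap fun _ ↦ Int.isClosedEmbedding_coe_real

/-- If any two points of `S` agree in one of two additive functionals, then one of
the functionals is constant on `S`. -/
theorem Set.exists_forall_eq_or_of_pairwise {α M N : Type*} {S : Set α} {f : α → M} {g : α → N}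
    (h : ∀ a ∈ S, ∀ b ∈ S, f a = f b ∨ g a = g b) {a : α} (ha : a ∈ S) :
    (∀ b ∈ S, f b = f a) ∨ ∀ b ∈ S, g b = g a := by
  grind

theorem exists_mem_sub_ne_zero_of_cover {n : ℕ} {K : Set (Fin n → ℝ)} (hK : IsCompact K)
    (hcov : ∀ x : Fin n → ℝ, ∃ y ∈ K, ∃ z : Fin n → ℤ, x = y + fun i => (z i : ℝ))
    {c d : (Fin n → ℝ) →L[ℝ] ℝ} {u v : Fin n → ℝ}
    (hcu : c u = 1) (hcv : c v = 0) (hdu : d u = 0) (hdv : d v = 1) :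
    ∃ z : Fin n → ℤ, (fun i ↦ (z i : ℝ)) ∈ K - K ∧
      c (fun i ↦ (z i : ℝ)) ≠ 0 ∧ d (fun i ↦ (z i : ℝ)) ≠ 0 := by
  by_contra! hcon
  have hemb := isClosedEmbedding_pi_intCast (Fin n)
  set e : (Fin n → ℤ) → Fin n → ℝ := fun z i ↦ (z i : ℝ)
  have he_sub (a b : Fin n → ℤ) : e (a - b) = e a - e b := by ext; simp [e]
  obtain ⟨U, hUo, hKU, hUb, hU⟩ : ∃ U : Set (Fin n → ℝ), IsOpen U ∧ K ⊆ U ∧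
      Bornology.IsBounded U ∧ ∀ x ∈ U, ∀ y ∈ U, ∀ z, x - y = e z → c (e z) = 0 ∨ d (e z) = 0 := by
    have hbad : IsClosed (e '' {z | c (e z) ≠ 0 ∧ d (e z) ≠ 0}) :=
      hemb.isClosedMap _ (isClosed_discrete _)
    obtain ⟨U₁, U₂, hU₁, hU₂, hK₁, hK₂, hsub⟩ := generalized_tube_lemma hK hK
      (hbad.isOpen_compl.preimage (f := fun p : (Fin n → ℝ) × (Fin n → ℝ) ↦ p.1 - p.2)
        (by fun_prop)) (by
          rintro ⟨x, y⟩ ⟨hx, hy⟩ ⟨z, ⟨hz1, hz2⟩, hz⟩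
          exact hz2 (hcon z ((show e z = x - y from hz) ▸ Set.sub_mem_sub hx hy : e z ∈ K - K) hz1))
    obtain ⟨R, hR⟩ := hK.isBounded.subset_ball 0
    refine ⟨U₁ ∩ U₂ ∩ Metric.ball 0 R, (hU₁.inter hU₂).inter Metric.isOpen_ball,
      Set.subset_inter (Set.subset_inter hK₁ hK₂) hR,
      Metric.isBounded_ball.subset Set.inter_subset_right, fun x hx y hy z hz ↦ ?_⟩
    by_contra! hne
    exact hsub (Set.mk_mem_prod hx.1.1 hy.1.2) ⟨z, hne, hz.symm⟩
  let p : ℂ → Fin n → ℝ := fun w ↦ w.re • u + w.im • v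
  have hp : Continuous p := by fun_prop
  let q : (Fin n → ℝ) → ℂ := fun x ↦ ⟨c x, d x⟩
  have hq : Continuous q := by
    have : q = fun x ↦ (c x : ℂ) + d x * Complex.I := by
      ext x
      apply Complex.ext <;> simp [q]
    rw [this]; fun_prop
  have hcp (w : ℂ) : c (p w) = w.re := by simp [p, hcu, hcv]
  have hdp (w : ℂ) : d (p w) = w.im := by simp [p, hdu, hdv]
  let V : (Fin n → ℤ) → Set ℂ := fun z ↦ {w | p w - e z ∈ U}
  have hVo (z) : IsOpen (V z) := hUo.preimage (by fun_prop)
  have hVcov : Set.univ ⊆ ⋃ z, V z := fun w _ ↦ by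
    obtain ⟨y, hy, z, hz⟩ := hcov (p w)
    refine Set.mem_iUnion.2 ⟨z, ?_⟩
    simpa [V, hz, e] using hKU hy
  have hVfin : LocallyFinite V := fun w ↦ by
    refine ⟨Metric.closedBall w 1, Metric.closedBall_mem_nhds _ one_pos, ?_⟩
    have hc : IsCompact (p '' Metric.closedBall w 1 - closure U) :=
      by
      rw [sub_eq_add_neg]
      exact ((isCompact_closedBall w 1).image hp).add hUb.isCompact_closure.neg
    refine (hemb.isCompact_preimage hc).finite_of_discrete.subset ?_
    rintro z ⟨w', hw', hw⟩
    exact ⟨p w', ⟨w', hw, rfl⟩, p w' - e z, subset_closure hw', by simp [e]⟩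
  obtain ⟨ρ, hρ⟩ := PartitionOfUnity.exists_isSubordinate_of_locallyFinite isClosed_univ V hVo
    hVfin hVcov
  have hρV {z w} (h : ρ z w ≠ 0) : p w - e z ∈ U := hρ z (subset_tsupport _ h)
  let g : ℂ → ℂ := fun w ↦ ∑ᶠ z, ρ z w • q (e z)
  have hg : Continuous g := ρ.continuous_finsum_smul fun _ _ _ ↦ continuousAt_const
  obtain ⟨B, hB⟩ := (hUb.isCompact_closure.image hq).isBounded.subset_closedBall 0
  have hgB (w : ℂ) : ‖g w - w‖ ≤ B := by
    rw [← mem_closedBall_iff_norm]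
    refine ρ.finsum_smul_mem_convex (g := fun z _ ↦ q (e z)) (Set.mem_univ w) (fun z hz ↦ ?_)
      (convex_closedBall w B)
    have hmem := hB ⟨_, subset_closure (hρV hz), rfl⟩
    rw [mem_closedBall_zero_iff] at hmem
    rw [mem_closedBall_iff_norm']
    rwa [show w - q (e z) = q (p w - e z) by apply Complex.ext <;> simp [q, hcp, hdp]]
  have hgr (w : ℂ) : (g w).re ∈ Set.range (fun z ↦ c (e z)) ∨
      (g w).im ∈ Set.range (fun z ↦ d (e z)) := by
    obtain ⟨a, ha⟩ : ∃ a, ρ a w ≠ 0 := by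
      by_contra! h
      simpa [h] using ρ.sum_eq_one (Set.mem_univ w)
    have hpair : ∀ a ∈ {z | ρ z w ≠ 0}, ∀ b ∈ {z | ρ z w ≠ 0},
        c (e a) = c (e b) ∨ d (e a) = d (e b) := fun a ha b hb ↦ by
      have := hU _ (hρV hb) _ (hρV ha) (a - b) (by rw [he_sub]; abel)
      simpa [he_sub, sub_eq_zero] using this
    refine (Set.exists_forall_eq_or_of_pairwise hpair ha).imp (fun h ↦ ⟨a, ?_⟩) fun h ↦ ⟨a, ?_⟩
    · exact (ρ.finsum_smul_mem_convex (g := fun z _ ↦ q (e z))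
        (t := {x | Complex.reLm x = c (e a)}) (Set.mem_univ w) h
        (convex_hyperplane Complex.reLm.isLinear _)).symm
    · exact (ρ.finsum_smul_mem_convex (g := fun z _ ↦ q (e z))
        (t := {x | Complex.imLm x = d (e a)}) (Set.mem_univ w) h
        (convex_hyperplane Complex.imLm.isLinear _)).symm
  have hex (f : (Fin n → ℤ) → ℝ) : ∃ r, r ∉ Set.range f := by
    by_contra! h
    exact Set.not_countable_univ ((Set.countable_range f).mono fun x _ ↦ h x)
  obtain ⟨r, hr⟩ := hex fun z ↦ c (e z)
  obtain ⟨s, hs⟩ := hex fun z ↦ d (e z)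
  obtain ⟨w, hw⟩ := Complex.exists_eq_zero_of_norm_sub_le (g := fun w ↦ g w - ⟨r, s⟩)
    (B := B + ‖(⟨r, s⟩ : ℂ)‖) (by fun_prop) fun w ↦ by
      rw [sub_right_comm]
      exact (norm_sub_le _ _).trans (by gcongr; exact hgB w)
  have := hgr w
  rw [sub_eq_zero.1 hw] at this
  exact this.elim hr hs

/-- For n ≥ 2, a compact `K ⊆ ℝⁿ` with `K + ℤⁿ = ℝⁿ`, and n
one-dimensional subspaces spanned by linearly independent vectors `v 0, …, v (n-1)`,
the set `(K - K) ∩ ℤⁿ` is not contained in the union of these n lines. -/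
theorem differences_not_in_union_of_independent_lines (n : ℕ) (hn : 2 ≤ n)
    (K : Set (Fin n → ℝ)) (hK : IsCompact K)
    (hcov : ∀ x : Fin n → ℝ, ∃ y ∈ K, ∃ z : Fin n → ℤ, x = y + fun i => (z i : ℝ))
    (v : Fin n → (Fin n → ℝ)) (hv : LinearIndependent ℝ v) :
    ¬ ∀ w : Fin n → ℝ, w ∈ K - K → (∀ i, ∃ m : ℤ, w i = (m : ℝ)) →
      ∃ l : Fin n, w ∈ Submodule.span ℝ ({v l} : Set (Fin n → ℝ)) := by
  intro h
  have : Nonempty (Fin n) := ⟨⟨0, by omega⟩⟩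
  let b := basisOfLinearIndependentOfCardEqFinrank hv (by simp)
  have hb (i j : Fin n) : b.coord i (v j) = if j = i then 1 else 0 := by
    rw [← show b j = v j by simp [b], b.coord_apply, b.repr_self, Finsupp.single_apply]
  let i : Fin n := ⟨0, by omega⟩
  let j : Fin n := ⟨1, by omega⟩
  have hij : i ≠ j := by simp [i, j]
  obtain ⟨z, hzK, hc, hd⟩ := exists_mem_sub_ne_zero_of_cover hK hcov
    (c := (b.coord i).toContinuousLinearMap) (d := (b.coord j).toContinuousLinearMap)
    (u := v i) (v := v j) (by simp [hb]) (by simp [hb, hij.symm]) (by simp [hb, hij])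
    (by simp [hb])
  obtain ⟨l, hl⟩ := h _ hzK fun k ↦ ⟨z k, rfl⟩
  obtain ⟨t, ht⟩ := Submodule.mem_span_singleton.1 hl
  rw [← ht] at hc hd
  simp only [LinearMap.coe_toContinuousLinearMap', map_smul, hb, smul_eq_mul] at hc hd
  grind
end

section
/- Let n ≥ 1 and let K ⊆ ℝ^n be a compact set with K + ℤ^n = ℝ^n. Then the set A = (K − K) ∩ ℤ^n is finite and generates ℤ^n as a group (i.e. A is a relatively prime set of lattice points). -/
open Pointwise

/-- The coordinatewise cast `ℤⁿ → ℝⁿ` is a closed embedding. -/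
theorem isClosedEmbedding_intCast_pi (n : ℕ) :
    Topology.IsClosedEmbedding fun (z : Fin n → ℤ) i => (z i : ℝ) :=
  Topology.IsClosedEmbedding.piMap fun _ => Int.isClosedEmbedding_coe_real

/-- For n ≥ 1 and a compact `K ⊆ ℝⁿ` with `K + ℤⁿ = ℝⁿ`, the set
`A = (K - K) ∩ ℤⁿ` is finite and generates `ℤⁿ` as a group. -/
theorem differences_finite_and_generate (n : ℕ) (hn : 1 ≤ n)
    (K : Set (Fin n → ℝ)) (hK : IsCompact K)
    (hcov : ∀ x : Fin n → ℝ, ∃ y ∈ K, ∃ z : Fin n → ℤ, x = y + fun i => (z i : ℝ)) :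
    Set.Finite {z : Fin n → ℤ | (fun i => (z i : ℝ)) ∈ K - K} ∧
      AddSubgroup.closure {z : Fin n → ℤ | (fun i => (z i : ℝ)) ∈ K - K} = ⊤ := by
  have hemb := isClosedEmbedding_intCast_pi n
  refine ⟨isCompact_iff_finite.1 (hemb.isCompact_preimage (by simpa only [sub_eq_add_neg] using hK.add hK.neg)), ?_⟩
  set G := AddSubgroup.closure {z : Fin n → ℤ | (fun i => (z i : ℝ)) ∈ K - K} with hG
  have hclosed (S : Set (Fin n → ℤ)) :
      IsClosed (K + (fun (z : Fin n → ℤ) i => (z i : ℝ)) '' S) :=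
    (hemb.isClosedMap S (isClosed_discrete S)).add_left_of_isCompact hK
  by_contra hne
  obtain ⟨w, hw⟩ : ∃ w, w ∉ G := by
    by_contra! h
    exact hne ((AddSubgroup.eq_top_iff' G).2 h)
  obtain ⟨k, hk, -⟩ := hcov 0
  -- `K + G` and `K + (ℤⁿ \ G)` are closed, nonempty and cover `ℝⁿ`, so they meet.
  obtain ⟨-, -, ⟨a, ha, -, ⟨g, hg, rfl⟩, rfl⟩, ⟨b, hb, -, ⟨z, hz, rfl⟩, hab⟩⟩ :=
    isPreconnected_closed_iff.1 isPreconnected_univ _ _ (hclosed (G : Set (Fin n → ℤ)))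
      (hclosed (G : Set (Fin n → ℤ))ᶜ)
      (fun x _ => by
        obtain ⟨y, hy, z, rfl⟩ := hcov x
        by_cases hz : z ∈ G
        · exact Or.inl (Set.add_mem_add hy ⟨z, hz, rfl⟩)
        · exact Or.inr (Set.add_mem_add hy ⟨z, hz, rfl⟩))
      ⟨_, trivial, Set.add_mem_add hk ⟨0, G.zero_mem, rfl⟩⟩
      ⟨_, trivial, Set.add_mem_add hk ⟨w, hw, rfl⟩⟩
  have hzg : z - g ∈ G := by
    refine AddSubgroup.subset_closure ⟨a, ha, b, hb, ?_⟩
    ext i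
    have := congrFun hab i
    simp only [Pi.add_apply, Pi.sub_apply, Int.cast_sub] at this ⊢
    linarith
  exact hz (by simpa using G.add_mem hzg hg)
end

section
/- Let A be a finite nonempty set of positive integers. Then gcd of the elements of A equals 1 (i.e. A is relatively prime) if and only if there exists a compact set K ⊆ ℝ with K + ℤ = ℝ such that A = (K − K) ∩ ℤ_{>0}. -/
open Pointwise

/-- If `K` is compact, its integer translates cover `ℝ`, and every integer in `K - K` is divisible
by `d`, then `d` is a unit. -/
theorem dvd_one_of_dvd_differences {K : Set ℝ} (hK : IsCompact K)
    (hcover : ∀ x : ℝ, ∃ y ∈ K, ∃ z : ℤ, x = y + (z : ℝ)) {d : ℤ}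
    (hd : ∀ m : ℤ, (m : ℝ) ∈ K - K → d ∣ m) : d ∣ 1 := by
  have hclosed : ∀ S : Set ℤ, IsClosed (K + (fun z : ℤ => (z : ℝ)) '' S) := fun S =>
    (Int.isClosedEmbedding_coe_real.isClosedMap S (isClosed_discrete S)).add_left_of_isCompact hK
  have hcompl : (K + (fun z : ℤ => (z : ℝ)) '' {z | d ∣ z})ᶜ =
      K + (fun z : ℤ => (z : ℝ)) '' {z | ¬ d ∣ z} := by
    ext x
    constructor
    · intro hx
      obtain ⟨y, hy, z, rfl⟩ := hcover x
      refine Set.add_mem_add hy ⟨z, fun hz => hx (Set.add_mem_add hy ⟨z, hz, rfl⟩), rfl⟩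
    · rintro ⟨y, hy, _, ⟨z, hz, rfl⟩, rfl⟩ ⟨y', hy', _, ⟨z', hz', rfl⟩, h⟩
      have hdvd := hd (z - z') ⟨y', hy', y, hy, by push_cast; simp only at h; linarith⟩
      exact hz ((dvd_sub_left hz').1 hdvd)
  have hclopen : IsClopen (K + (fun z : ℤ => (z : ℝ)) '' {z | d ∣ z}) :=
    ⟨hclosed _, isClosed_compl_iff.1 (hcompl ▸ hclosed _)⟩
  obtain ⟨x, hx, -⟩ := hcover 0
  have huniv := hclopen.eq_univ ⟨x + (0 : ℤ), Set.add_mem_add hx ⟨0, dvd_zero d, rfl⟩⟩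
  obtain ⟨y, hy, _, ⟨z, hz, rfl⟩, h⟩ := huniv ▸ Set.mem_univ (x + 1)
  have hdvd := hd (1 - z) ⟨y, hy, x, hx, by push_cast; simp only at h; linarith⟩
  exact (dvd_sub_left hz).1 hdvd

/-- A relatively prime finite set of positive integers supplies signed steps with sum `1` that use
every element of the set. -/
theorem exists_signed_list_sum_eq_one {A : Finset ℤ} (hpos : ∀ a ∈ A, 0 < a)
    (hgcd : A.gcd id = 1) :
    ∃ l : List ℤ, l.sum = 1 ∧ (∀ x ∈ l, |x| ∈ A) ∧ ∀ a ∈ A, a ∈ l := by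
  have hmem : (1 : ℤ) ∈ AddSubgroup.closure (A : Set ℤ) := by
    obtain ⟨d, hd⟩ := Int.subgroup_cyclic (AddSubgroup.closure (A : Set ℤ))
    rw [← AddSubgroup.zmultiples_eq_closure] at hd
    rw [hd, Int.mem_zmultiples_iff, ← hgcd]
    refine Finset.dvd_gcd fun a ha => ?_
    rw [id, ← Int.mem_zmultiples_iff, ← hd]
    exact AddSubgroup.subset_closure ha
  rw [← AddSubgroup.mem_toAddSubmonoid, AddSubgroup.closure_toAddSubmonoid] at hmem
  obtain ⟨l, hl, hsum⟩ := AddSubmonoid.exists_list_of_mem_closure hmem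
  have habs : ∀ a ∈ A, |a| ∈ A := fun a ha => by rwa [abs_of_pos (hpos a ha)]
  refine ⟨l ++ A.toList ++ A.toList.map Neg.neg, ?_, ?_, ?_⟩
  · have hneg : (A.toList.map Neg.neg).sum = -A.toList.sum := (List.sum_neg _).symm
    rw [List.sum_append, List.sum_append, hsum, hneg]
    ring
  · intro x hx
    simp only [List.mem_append, Finset.mem_toList, List.mem_map] at hx
    rcases hx with (hx | hx) | ⟨a, ha, rfl⟩
    · rcases hl x hx with h | h
      · exact habs x h
      · exact abs_neg x ▸ habs _ h
    · exact habs x hx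
    · rw [abs_neg]
      exact habs a ha
  · intro a ha
    simp [ha]

/-- A relatively prime finite set of positive integers is the set of absolute values of the steps
of a walk on `ℤ` from `0` to `1`. -/
theorem exists_walk_of_gcd_eq_one {A : Finset ℤ} (hpos : ∀ a ∈ A, 0 < a)
    (hgcd : A.gcd id = 1) :
    ∃ (k : ℕ) (n : ℕ → ℤ), 0 < k ∧ n 0 = 0 ∧ n k = 1 ∧
      (∀ i < k, |n (i + 1) - n i| ∈ A) ∧ ∀ a ∈ A, ∃ i < k, |n (i + 1) - n i| = a := by
  obtain ⟨l, hsum, hl, hA⟩ := exists_signed_list_sum_eq_one hpos hgcd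
  have hstep : ∀ i (hi : i < l.length), (l.take (i + 1)).sum - (l.take i).sum = l[i] := by
    intro i hi
    rw [List.sum_take_succ _ _ hi]
    ring
  refine ⟨l.length, fun i => (l.take i).sum, ?_, by simp, by simpa using hsum, ?_, ?_⟩
  · rw [List.length_pos_iff]
    rintro rfl
    simp at hsum
  · intro i hi
    rw [hstep i hi]
    exact hl _ (List.getElem_mem hi)
  · intro a ha
    obtain ⟨i, hi, rfl⟩ := List.getElem_of_mem (hA a ha)
    exact ⟨i, hi, by rw [hstep i hi, abs_of_pos (hpos _ ha)]⟩

/-- The union of the intervals `[i / k, (i + 1) / k] - n (i + 1)` for `i < k`. -/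
def shiftedIntervals (k : ℕ) (n : ℕ → ℤ) : Set ℝ :=
  ⋃ i ∈ Finset.range k, (fun u : ℝ => u / k - n (i + 1)) '' Set.Icc (i : ℝ) (i + 1)

theorem mem_shiftedIntervals {k : ℕ} {n : ℕ → ℤ} {x : ℝ} :
    x ∈ shiftedIntervals k n ↔
      ∃ i < k, ∃ u : ℝ, (i : ℝ) ≤ u ∧ u ≤ i + 1 ∧ u / k - n (i + 1) = x := by
  simp [shiftedIntervals, and_assoc]

theorem isCompact_shiftedIntervals (k : ℕ) (n : ℕ → ℤ) : IsCompact (shiftedIntervals k n) :=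
  (Finset.range k).isCompact_biUnion fun _ _ =>
    isCompact_Icc.image ((continuous_id.div_const _).sub continuous_const)

theorem shiftedIntervals_add_int {k : ℕ} (hk : 0 < k) (n : ℕ → ℤ) (x : ℝ) :
    ∃ y ∈ shiftedIntervals k n, ∃ z : ℤ, x = y + (z : ℝ) := by
  have hk' : (0 : ℝ) < k := by exact_mod_cast hk
  have hnonneg : 0 ≤ Int.fract x * k := mul_nonneg (Int.fract_nonneg x) hk'.le
  have hlt : Int.fract x * k < k := by nlinarith [Int.fract_lt_one x]
  refine ⟨Int.fract x - n (⌊Int.fract x * k⌋₊ + 1), mem_shiftedIntervals.2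
    ⟨⌊Int.fract x * k⌋₊, (Nat.floor_lt hnonneg).2 hlt, Int.fract x * k,
      Nat.floor_le hnonneg, (Nat.lt_floor_add_one _).le, ?_⟩,
    ⌊x⌋ + n (⌊Int.fract x * k⌋₊ + 1), ?_⟩
  · rw [mul_div_cancel_right₀ _ hk'.ne']
  · push_cast
    linarith [Int.floor_add_fract x]

theorem step_mem_sub_shiftedIntervals {k : ℕ} {n : ℕ → ℤ} (h0 : n 0 = 0) (h1 : n k = 1)
    {i : ℕ} (hi : i < k) :
    ((n (i + 1) - n i : ℤ) : ℝ) ∈ shiftedIntervals k n - shiftedIntervals k n := by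
  have hk : (k : ℝ) ≠ 0 := by exact_mod_cast (by omega : k ≠ 0)
  rcases i with _ | i
  · obtain ⟨j, rfl⟩ : ∃ j, k = j + 1 := ⟨k - 1, by omega⟩
    refine ⟨1 - n (j + 1), mem_shiftedIntervals.2 ⟨j, by omega, j + 1, by linarith, le_rfl, ?_⟩,
      0 - n 1, mem_shiftedIntervals.2 ⟨0, by omega, 0, by simp, by simp, by simp⟩, ?_⟩
    · push_cast at hk ⊢
      rw [div_self hk]
    · simp [h0, h1]
  · refine ⟨(i + 1 : ℝ) / k - n (i + 1),
      mem_shiftedIntervals.2 ⟨i, by omega, i + 1, by linarith, le_rfl, rfl⟩,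
      (i + 1 : ℝ) / k - n (i + 1 + 1),
      mem_shiftedIntervals.2 ⟨i + 1, hi, i + 1, by simp, by simp, rfl⟩, ?_⟩
    push_cast
    ring

theorem exists_step_of_mem_sub_shiftedIntervals {k : ℕ} {n : ℕ → ℤ} (h0 : n 0 = 0)
    (h1 : n k = 1) {m : ℤ} (hm : 0 < m)
    (h : (m : ℝ) ∈ shiftedIntervals k n - shiftedIntervals k n) :
    ∃ i < k, m = |n (i + 1) - n i| := by
  suffices ∃ i < k, m = n (i + 1) - n i ∨ -m = n (i + 1) - n i by
    obtain ⟨i, hi, h | h⟩ := this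
    · exact ⟨i, hi, by rw [← h, abs_of_pos hm]⟩
    · exact ⟨i, hi, by rw [← h, abs_neg, abs_of_pos hm]⟩
  obtain ⟨x, hx, y, hy, hxy⟩ := h
  obtain ⟨i, hi, u, hiu, hui, rfl⟩ := mem_shiftedIntervals.1 hx
  obtain ⟨j, hj, v, hjv, hvj, rfl⟩ := mem_shiftedIntervals.1 hy
  have hk : (0 : ℝ) < k := by exact_mod_cast (by omega : 0 < k)
  obtain ⟨q, hq⟩ : ∃ q : ℤ, q = m + n (i + 1) - n (j + 1) := ⟨_, rfl⟩
  have huv : u - v = k * q := by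
    have : (q : ℝ) = u / k - v / k := by
      rw [hq]
      push_cast
      simp only at hxy
      linarith
    rw [this]
    field_simp
  have hupper : (k : ℤ) * q ≤ i - j + 1 := by
    have : (k : ℝ) * q ≤ i - j + 1 := by linarith
    exact_mod_cast this
  have hlower : (i : ℤ) - j - 1 ≤ k * q := by
    have : (i : ℝ) - j - 1 ≤ k * q := by linarith
    exact_mod_cast this
  have hq1 : q ≤ 1 := by
    by_contra! hc
    nlinarith
  have hq2 : -1 ≤ q := by
    by_contra! hc
    nlinarith
  obtain rfl | rfl | rfl : q = -1 ∨ q = 0 ∨ q = 1 := by omega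
  · obtain rfl : i = 0 := by omega
    obtain rfl : k = j + 1 := by omega
    exact ⟨0, hi, by right; simp only [zero_add] at hq ⊢; omega⟩
  · obtain rfl | rfl | rfl : i = j ∨ i = j + 1 ∨ j = i + 1 := by omega
    · omega
    · exact ⟨j + 1, hi, by omega⟩
    · exact ⟨i + 1, hj, by omega⟩
  · obtain rfl : j = 0 := by omega
    obtain rfl : k = i + 1 := by omega
    exact ⟨0, hj, by left; simp only [zero_add] at hq ⊢; omega⟩

/-- A finite nonempty set of positive integers has gcd 1 iff it is the
set of positive integers in `K - K` for some compact `K ⊆ ℝ` with `K + ℤ = ℝ`. -/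
theorem relatively_prime_iff_differences_of_Nset (A : Finset ℤ) (hne : A.Nonempty)
    (hpos : ∀ a ∈ A, 0 < a) :
    A.gcd id = 1 ↔
      ∃ K : Set ℝ, IsCompact K ∧
        (∀ x : ℝ, ∃ y ∈ K, ∃ z : ℤ, x = y + (z : ℝ)) ∧
        (∀ m : ℤ, m ∈ A ↔ (0 < m ∧ (m : ℝ) ∈ K - K)) := by
  constructor
  · intro hgcd
    obtain ⟨k, n, hk, h0, h1, hstep, hA⟩ := exists_walk_of_gcd_eq_one hpos hgcd
    refine ⟨shiftedIntervals k n, isCompact_shiftedIntervals k n,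
      shiftedIntervals_add_int hk n, fun m => ⟨fun hm => ⟨hpos m hm, ?_⟩, ?_⟩⟩
    · obtain ⟨i, hi, rfl⟩ := hA m hm
      have hmem := step_mem_sub_shiftedIntervals h0 h1 hi
      rcases abs_choice (n (i + 1) - n i) with h | h
      · rwa [h]
      · rw [h, Int.cast_neg, ← Set.mem_neg, neg_sub]
        exact hmem
    · rintro ⟨hm, hmem⟩
      obtain ⟨i, hi, rfl⟩ := exists_step_of_mem_sub_shiftedIntervals h0 h1 hm hmem
      exact hstep i hi
  · rintro ⟨K, hK, hcover, hA⟩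
    have hdvd : A.gcd id ∣ 1 := by
      refine dvd_one_of_dvd_differences hK hcover fun m hm => ?_
      rcases lt_trichotomy m 0 with h | rfl | h
      · refine (dvd_neg).1 (Finset.gcd_dvd (f := id) ((hA (-m)).2 ⟨by omega, ?_⟩))
        rw [Int.cast_neg, ← Set.mem_neg, neg_sub]
        exact hm
      · exact dvd_zero _
      · exact Finset.gcd_dvd (f := id) ((hA m).2 ⟨h, hm⟩)
    rw [← Finset.normalize_gcd]
    exact normalize_eq_one.2 (isUnit_of_dvd_one hdvd)
end

section
/- Let n ≥ 1 and let K be a compact subset of ℝ^n. For J = (j_1, …, j_n) ∈ ℤ^n and an integer N, let C_{N,J} = [j_1/2^N, (j_1+1)/2^N] × ⋯ × [j_n/2^N, (j_n+1)/2^N]. Then there exists an integer N_0 such that for every integer N ≥ N_0 there is a finite subset 𝒥 of ℤ^n such that the set K_N = ⋃_{J ∈ 𝒥} C_{N,J} satisfies K ⊆ K_N and (K − K) ∩ ℤ^n = (K_N − K_N) ∩ ℤ^n. -/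
open Pointwise

/-- Any set of integer points of `ℝⁿ` is closed. -/
lemma isClosed_of_subset_range_intCast {n : ℕ} {S : Set (Fin n → ℝ)}
    (hS : S ⊆ Set.range fun (z : Fin n → ℤ) i => (z i : ℝ)) : IsClosed S := by
  refine Metric.isClosed_of_pairwise_le_dist one_pos fun x hx y hy hxy => ?_
  obtain ⟨a, rfl⟩ := hS hx
  obtain ⟨b, rfl⟩ := hS hy
  obtain ⟨i, hi⟩ := Function.ne_iff.mp hxy
  refine le_trans ?_ (dist_le_pi_dist _ _ i)
  simp only [Int.dist_cast_real]
  exact Int.pairwise_one_le_dist fun h => hi (by simp [h])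

/-- Integer points close enough to a compact set belong to it. -/
lemma IsCompact.exists_pos_forall_intCast_mem {n : ℕ} {D : Set (Fin n → ℝ)} (hD : IsCompact D) :
    ∃ δ > 0, ∀ z : Fin n → ℤ, ∀ d ∈ D, dist (fun i => (z i : ℝ)) d < δ →
      (fun i => (z i : ℝ)) ∈ D := by
  have hS : IsClosed ((Set.range fun (z : Fin n → ℤ) i => (z i : ℝ)) \ D) :=
    isClosed_of_subset_range_intCast Set.sdiff_subset
  obtain ⟨δ, hδ, h⟩ := hD.exists_thickening_subset_open hS.isOpen_compl
    fun d hd hd' => hd'.2 hd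
  refine ⟨δ, hδ, fun z d hd hzd => ?_⟩
  by_contra hz
  exact h (Metric.mem_thickening_iff.mpr ⟨d, hd, hzd⟩) ⟨⟨z, rfl⟩, hz⟩

/-- The difference set of two compact sets is compact. -/
lemma IsCompact.set_sub {G : Type*} [TopologicalSpace G] [Sub G] [ContinuousSub G] {s t : Set G}
    (hs : IsCompact s) (ht : IsCompact t) : IsCompact (s - t) := by
  rw [← Set.sub_image_prod]
  exact (hs.prod ht).image continuous_sub

/-- Only finitely many cells of a cubic grid meet a bounded set. -/
lemma Bornology.IsBounded.finite_image_floor_mul {n : ℕ} {K : Set (Fin n → ℝ)}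
    (hK : Bornology.IsBounded K) {c : ℝ} (hc : 0 < c) :
    ((fun (k : Fin n → ℝ) i => ⌊c * k i⌋) '' K).Finite := by
  obtain ⟨R, hR⟩ := hK.exists_norm_le
  refine (Set.finite_Icc (fun _ => ⌊c * -R⌋) (fun _ => ⌊c * R⌋)).subset ?_
  rintro _ ⟨k, hk, rfl⟩
  have h i := abs_le.mp ((norm_le_pi_norm k i).trans (hR k hk))
  exact ⟨fun i => Int.floor_mono (mul_le_mul_of_nonneg_left (h i).1 hc.le),
    fun i => Int.floor_mono (mul_le_mul_of_nonneg_left (h i).2 hc.le)⟩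

/-- Any compact `K ⊆ ℝⁿ` can, for all sufficiently large `N`, be covered by a
finite union `K_N` of dyadic cubes of side `1/2^N` with
`(K - K) ∩ ℤⁿ = (K_N - K_N) ∩ ℤⁿ`. -/
theorem dyadic_cube_approximation (n : ℕ) (hn : 1 ≤ n)
    (K : Set (Fin n → ℝ)) (hK : IsCompact K) :
    ∃ N₀ : ℤ, ∀ N : ℤ, N₀ ≤ N →
      ∃ 𝒥 : Finset (Fin n → ℤ),
        K ⊆ (⋃ J ∈ 𝒥, {x : Fin n → ℝ |
            ∀ i, (J i : ℝ) / 2 ^ N ≤ x i ∧ x i ≤ ((J i : ℝ) + 1) / 2 ^ N}) ∧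
        ∀ z : Fin n → ℤ,
          ((fun i => (z i : ℝ)) ∈ K - K ↔
            (fun i => (z i : ℝ)) ∈
              (⋃ J ∈ 𝒥, {x : Fin n → ℝ |
                  ∀ i, (J i : ℝ) / 2 ^ N ≤ x i ∧ x i ≤ ((J i : ℝ) + 1) / 2 ^ N}) -
              (⋃ J ∈ 𝒥, {x : Fin n → ℝ |
                  ∀ i, (J i : ℝ) / 2 ^ N ≤ x i ∧ x i ≤ ((J i : ℝ) + 1) / 2 ^ N})) := by
  obtain ⟨δ, hδ, hD⟩ := (hK.set_sub hK).exists_pos_forall_intCast_mem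
  obtain ⟨m, hm⟩ := pow_unbounded_of_one_lt (2 / δ) (one_lt_two (α := ℝ))
  refine ⟨m, fun N hN => ?_⟩
  have hc : (0 : ℝ) < 2 ^ N := by positivity
  have hcδ : 1 / (2 : ℝ) ^ N + 1 / 2 ^ N < δ := by
    have h : (2 : ℝ) ^ m ≤ 2 ^ N := by
      rw [← zpow_natCast]
      exact zpow_le_zpow_right₀ one_le_two hN
    rw [← add_div, one_add_one_eq_two, div_lt_comm₀ hc hδ]
    exact hm.trans_le h
  have hfin := hK.isBounded.finite_image_floor_mul hc
  have cell (k : Fin n → ℝ) (i : Fin n) : (⌊2 ^ N * k i⌋ : ℝ) / 2 ^ N ≤ k i ∧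
      k i ≤ ((⌊2 ^ N * k i⌋ : ℝ) + 1) / 2 ^ N := by
    rw [div_le_iff₀' hc, le_div_iff₀' hc]
    exact ⟨Int.floor_le _, (Int.lt_floor_add_one _).le⟩
  have cover : K ⊆ ⋃ J ∈ hfin.toFinset, {x : Fin n → ℝ |
      ∀ i, (J i : ℝ) / 2 ^ N ≤ x i ∧ x i ≤ ((J i : ℝ) + 1) / 2 ^ N} := fun k hk =>
    Set.mem_iUnion₂.mpr ⟨_, hfin.mem_toFinset.mpr ⟨k, hk, rfl⟩, cell k⟩
  have near : ∀ x ∈ ⋃ J ∈ hfin.toFinset, {x : Fin n → ℝ |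
      ∀ i, (J i : ℝ) / 2 ^ N ≤ x i ∧ x i ≤ ((J i : ℝ) + 1) / 2 ^ N},
      ∃ k ∈ K, dist x k ≤ 1 / 2 ^ N := by
    intro x hx
    obtain ⟨J, hJ, hxJ⟩ := Set.mem_iUnion₂.mp hx
    obtain ⟨k, hk, rfl⟩ := hfin.mem_toFinset.mp hJ
    refine ⟨k, hk, (dist_pi_le_iff (by positivity)).mpr fun i => ?_⟩
    have h₁ := hxJ i
    have h₂ := cell k i
    rw [add_div] at h₁ h₂
    rw [Real.dist_eq, abs_le]
    constructor <;> linarith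
  refine ⟨hfin.toFinset, cover, fun z => ⟨fun hz => Set.sub_subset_sub cover cover hz, ?_⟩⟩
  rintro ⟨x, hx, y, hy, hxy⟩
  obtain ⟨k, hk, hxk⟩ := near x hx
  obtain ⟨l, hl, hyl⟩ := near y hy
  refine hD z (k - l) (Set.sub_mem_sub hk hl) ?_
  rw [← hxy]
  exact ((dist_sub_sub_le x y k l).trans (add_le_add hxk hyl)).trans_lt hcδ
end

section
/- The set A = {(−1,0), (0,−1), (0,0), (1,0), (0,1)} ⊆ ℤ^2 is a finite symmetric set of relatively prime lattice points containing 0, yet there is no compact set K ⊆ ℝ^2 with K + ℤ^2 = ℝ^2 such that A = (K − K) ∩ ℤ^2. -/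
open Pointwise

open Complex Set in
/-- Two continuous logarithms of a function with values in the slit plane differ by a constant. -/
lemma IsPreconnected.sub_log_eq {X : Type*} [TopologicalSpace X] {S : Set X}
    (hS : IsPreconnected S) {h g : X → ℂ} (hh : ContinuousOn h S) (hg : ContinuousOn g S)
    (he : ∀ x ∈ S, exp (h x) = g x) (hs : ∀ x ∈ S, g x ∈ slitPlane) {x y : X}
    (hx : x ∈ S) (hy : y ∈ S) : h x - log (g x) = h y - log (g y) := by
  have hT : IsDiscrete (exp ⁻¹' {1}) :=
    isDiscrete_iff_discreteTopology.2 (isCoveringMapOn_exp 1 (by simp)).1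
  refine hS.constant_of_mapsTo (f := fun x ↦ h x - log (g x)) hT (hh.sub (hg.clog hs)) ?_ hx hy
  intro z hz
  have h0 : g z ≠ 0 := slitPlane_ne_zero (hs z hz)
  simp [exp_sub, exp_log h0, he z hz, h0]

open Complex Set in
/-- A continuous planar map sending each side of a square into the open half plane on the same side
of the origin has a zero near the square. -/
lemma exists_eq_zero_of_sides {g : ℝ × ℝ → ℂ} (hg : Continuous g) {N M : ℝ} (hN : 0 < N)
    (hNM : N < M)
    (hr : ∀ y, |y| ≤ N → 0 < (g (N, y)).re) (hl : ∀ y, |y| ≤ N → (g (-N, y)).re < 0)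
    (ht : ∀ x, |x| ≤ N → 0 < (g (x, N)).im) (hb : ∀ x, |x| ≤ N → (g (x, -N)).im < 0) :
    ∃ x : ℝ × ℝ, |x.1| < M ∧ |x.2| < M ∧ g x = 0 := by
  by_contra! hne
  set U : Set (ℝ × ℝ) := Ioo (-M) M ×ˢ Ioo (-M) M with hU
  have hUo : IsOpen U := isOpen_Ioo.prod isOpen_Ioo
  have hUc : Convex ℝ U := (convex_Ioo _ _).prod (convex_Ioo _ _)
  have hUn : U.Nonempty := ⟨(0, 0), by simp [hU]; linarith⟩
  have hUs : IsSimplyConnected U := by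
    have : ContractibleSpace U := hUc.contractibleSpace hUn
    exact (inferInstance : SimplyConnectedSpace U)
  obtain ⟨h, hhc, hh⟩ := exists_continuousOn_eqOn_exp_comp hUs hUo hg.continuousOn (by
    rintro ⟨x, ⟨⟨h1, h2⟩, h3, h4⟩, hx⟩
    exact hne x (abs_lt.2 ⟨h1, h2⟩) (abs_lt.2 ⟨h3, h4⟩) hx)
  set I : Set ℝ := Icc (-N) N with hI
  have hIp : IsPreconnected I := isPreconnected_Icc
  have habs {y : ℝ} (hy : y ∈ I) : |y| ≤ N := abs_le.2 hy
  have hNI : N ∈ I := ⟨by linarith, le_rfl⟩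
  have hNI' : -N ∈ I := ⟨le_rfl, by linarith⟩
  have hIU : I ×ˢ I ⊆ U := by
    rintro ⟨x, y⟩ ⟨⟨h1, h2⟩, h3, h4⟩
    simp only at h1 h2 h3 h4
    refine ⟨⟨?_, ?_⟩, ?_, ?_⟩ <;> simp only <;> linarith
  set L : Set (ℝ × ℝ) := {-N} ×ˢ I
  set T : Set (ℝ × ℝ) := I ×ˢ {N}
  set R : Set (ℝ × ℝ) := {N} ×ˢ I
  set B : Set (ℝ × ℝ) := I ×ˢ {-N}
  have hLU : L ⊆ U := (prod_mono (by simpa using hNI') le_rfl).trans hIU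
  have hTU : T ⊆ U := (prod_mono le_rfl (by simpa using hNI)).trans hIU
  have hRU : R ⊆ U := (prod_mono (by simpa using hNI) le_rfl).trans hIU
  have hBU : B ⊆ U := (prod_mono le_rfl (by simpa using hNI')).trans hIU
  have hSU : T ∪ R ∪ B ⊆ U := union_subset (union_subset hTU hRU) hBU
  have hSp : IsPreconnected (T ∪ R ∪ B) := by
    refine IsPreconnected.union (N, -N) (.inr ⟨rfl, hNI'⟩) ⟨hNI, rfl⟩
      (IsPreconnected.union (N, N) ⟨hNI, rfl⟩ ⟨rfl, hNI⟩ ?_ ?_) ?_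
    · exact hIp.prod isPreconnected_singleton
    · exact isPreconnected_singleton.prod hIp
    · exact hIp.prod isPreconnected_singleton
  have e1 := hSp.sub_log_eq (hhc.mono hSU) hg.continuousOn (fun x hx ↦ hh (hSU hx)) (by
    rintro ⟨x, y⟩ ((⟨hx, rfl⟩ | ⟨rfl, hy⟩) | ⟨hx, rfl⟩)
    · exact .inr (ht x (habs hx)).ne'
    · exact .inl (hr y (habs hy))
    · exact .inr (hb x (habs hx)).ne)
    (x := (-N, N)) (y := (-N, -N)) (.inl (.inl ⟨hNI', rfl⟩)) (.inr ⟨hNI', rfl⟩)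
  have e2 := (isPreconnected_singleton.prod hIp : IsPreconnected L).sub_log_eq
    (h := fun x ↦ h x + Real.pi * Complex.I) (g := fun x ↦ - g x)
    ((hhc.mono hLU).add continuousOn_const) hg.neg.continuousOn
    (fun x hx ↦ by
      have := hh (hLU hx)
      simp only [Function.comp_apply] at this
      simp [exp_add, this]) (by
    rintro ⟨x, y⟩ ⟨rfl, hy⟩
    refine .inl ?_
    simpa using hl y (habs hy))
    (x := (-N, N)) (y := (-N, -N)) ⟨rfl, hNI⟩ ⟨rfl, hNI'⟩
  have tl := ht (-N) (habs hNI')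
  have bl := hb (-N) (habs hNI')
  replace e1 := congrArg Complex.im e1
  replace e2 := congrArg Complex.im e2
  simp only [sub_im, log_im, add_im] at e1 e2
  have a1 : 0 ≤ arg (g (-N, N)) := arg_nonneg_iff.2 tl.le
  have a2 : arg (g (-N, -N)) < 0 := arg_neg_iff.2 bl
  have a3 : arg (-g (-N, N)) < 0 := arg_neg_iff.2 (by simpa using tl)
  have a4 : 0 ≤ arg (-g (-N, -N)) := arg_nonneg_iff.2 (by simpa using bl.le)
  linarith

/-- The map `ℤ² → ℝ²`. -/
def latticePoint (z : ℤ × ℤ) : ℝ × ℝ := ((z.1 : ℝ), (z.2 : ℝ))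

open Metric in
/-- A compact set has a positive-width neighbourhood whose difference set contains no lattice points
other than those of the difference set of the set itself. -/
lemma IsCompact.exists_thickening_sub_lattice {K : Set (ℝ × ℝ)} (hK : IsCompact K) :
    ∃ ε > 0, ∀ z : ℤ × ℤ, ∀ x ∈ thickening ε K, ∀ y ∈ thickening ε K,
      latticePoint z = x - y → latticePoint z ∈ K - K := by
  have hemb : Topology.IsClosedEmbedding latticePoint :=
    Int.isClosedEmbedding_coe_real.prodMap Int.isClosedEmbedding_coe_real
  have hB : IsClosed (latticePoint '' {z | latticePoint z ∉ K - K}) :=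
    hemb.isClosedMap _ (isClosed_discrete _)
  have hKK : IsCompact (K - K) := by
    rw [sub_eq_add_neg]
    exact hK.add hK.neg
  obtain ⟨δ, hδ, hsub⟩ := hKK.exists_thickening_subset_open hB.isOpen_compl (by
    rintro x hx ⟨z, hz, rfl⟩
    exact hz hx)
  refine ⟨δ / 2, by positivity, fun z x hx y hy hz ↦ ?_⟩
  by_contra hzK
  rw [mem_thickening_iff] at hx hy
  obtain ⟨k, hk, hxk⟩ := hx
  obtain ⟨l, hl, hyl⟩ := hy
  refine hsub (mem_thickening_iff.2 ⟨k - l, Set.sub_mem_sub hk hl, ?_⟩) ⟨z, hzK, hz⟩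
  calc dist (x - y) (k - l) ≤ dist x k + dist y l := dist_sub_sub_le _ _ _ _
    _ < δ := by linarith

/-- A set of lattice points whose pairwise differences are zero or unit vectors along the
axes lies on a horizontal or on a vertical line. -/
lemma fst_eq_or_snd_eq_of_sub_mem_cross {P : ℤ × ℤ → Prop}
    (hP : ∀ z w, P z → P w →
      z - w ∈ ({(-1, 0), (0, -1), (0, 0), (1, 0), (0, 1)} : Set (ℤ × ℤ)))
    {z : ℤ × ℤ} (hz : P z) : (∀ w, P w → w.1 = z.1) ∨ (∀ w, P w → w.2 = z.2) := by
  by_contra! hcon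
  obtain ⟨⟨w, hw, hwz⟩, v, hv, hvz⟩ := hcon
  have h1 := hP w z hw hz
  have h2 := hP v z hv hz
  have h3 := hP w v hw hv
  simp only [Set.mem_insert_iff, Set.mem_singleton_iff, Prod.ext_iff, Prod.fst_sub,
    Prod.snd_sub] at h1 h2 h3
  omega

lemma closure_cross :
    AddSubgroup.closure ({(-1, 0), (0, -1), (0, 0), (1, 0), (0, 1)} : Set (ℤ × ℤ)) = ⊤ := by
  refine eq_top_iff.2 fun z _ ↦ ?_
  have hz : z = z.1 • ((1, 0) : ℤ × ℤ) + z.2 • ((0, 1) : ℤ × ℤ) := by ext <;> simp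
  rw [hz]
  exact add_mem (zsmul_mem (AddSubgroup.subset_closure (by simp)) _)
    (zsmul_mem (AddSubgroup.subset_closure (by simp)) _)

open Metric in
/-- No compact set covering the plane by lattice translates has the cross as its set of lattice
differences. -/
lemma not_exists_cross_cover : ¬ ∃ K : Set (ℝ × ℝ), IsCompact K ∧
    (∀ x : ℝ × ℝ, ∃ y ∈ K, ∃ z : ℤ × ℤ, x = y + latticePoint z) ∧
    (∀ z : ℤ × ℤ, z ∈ ({(-1, 0), (0, -1), (0, 0), (1, 0), (0, 1)} : Set (ℤ × ℤ)) ↔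
      latticePoint z ∈ K - K) := by
  rintro ⟨K, hK, hcov, hdiff⟩
  obtain ⟨ε, hε, hεK⟩ := hK.exists_thickening_sub_lattice
  have hKne : K.Nonempty := let ⟨y, hy, _⟩ := hcov 0; ⟨y, hy⟩
  obtain ⟨r, hr⟩ := (hK.isBounded.thickening (δ := ε)).subset_closedBall 0
  have hbd : ∀ x ∈ thickening ε K, |x.1| ≤ r ∧ |x.2| ≤ r := fun x hx ↦ by
    have := hr hx
    rw [mem_closedBall, dist_zero_right, Prod.norm_def] at this
    exact max_le_iff.1 this
  have hr0 : 0 ≤ r := by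
    obtain ⟨y, hy⟩ := hKne
    exact (abs_nonneg _).trans (hbd y (self_subset_thickening hε K hy)).1
  let φ : ℝ × ℝ → ℝ := fun x ↦ max 0 (ε - infDist x K)
  have hφc : Continuous φ := continuous_const.max (continuous_const.sub (continuous_infDist_pt K))
  have hφ0 : ∀ x, 0 ≤ φ x := fun x ↦ le_max_left _ _
  have hφpos : ∀ x, 0 < φ x ↔ x ∈ thickening ε K := fun x ↦ by
    simp [φ, mem_thickening_iff_infDist_lt hKne]
  obtain ⟨m, hm⟩ := exists_nat_ge (2 * r + 2)
  let F : Finset (ℤ × ℤ) := Finset.Icc (-m : ℤ) m ×ˢ Finset.Icc (-m : ℤ) m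
  let S : ℝ × ℝ → ((ℤ × ℤ) → ℝ) → ℝ := fun x c ↦ ∑ z ∈ F, φ (x - latticePoint z) * c z
  have hSc : ∀ c, Continuous fun x ↦ S x c := fun c ↦
    continuous_finsetSum _ fun z _ ↦
      (hφc.comp (continuous_id.sub continuous_const)).mul continuous_const
  have hcov' : ∀ x : ℝ × ℝ, |x.1| < r + 2 → |x.2| < r + 2 →
      ∃ z ∈ F, 0 < φ (x - latticePoint z) := by
    intro x h1 h2
    obtain ⟨y, hy, z, rfl⟩ := hcov x
    have hyt := self_subset_thickening hε K hy
    obtain ⟨b1, b2⟩ := hbd y hyt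
    simp only [latticePoint, Prod.fst_add, Prod.snd_add, abs_lt, abs_le] at h1 h2 b1 b2
    refine ⟨z, ?_, by simpa [hφpos] using hyt⟩
    simp only [F, Finset.mem_product, Finset.mem_Icc]
    refine ⟨⟨?_, ?_⟩, ?_, ?_⟩ <;> · rify; linarith
  have hSpos : ∀ x : ℝ × ℝ, |x.1| < r + 2 → |x.2| < r + 2 → ∀ c : ℤ × ℤ → ℝ,
      (∀ z, 0 < φ (x - latticePoint z) → 0 < c z) → 0 < S x c := by
    intro x h1 h2 c hc
    obtain ⟨z, hz, hzφ⟩ := hcov' x h1 h2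
    refine Finset.sum_pos' (fun w _ ↦ ?_) ⟨z, hz, mul_pos hzφ (hc z hzφ)⟩
    rcases (hφ0 (x - latticePoint w)).eq_or_lt with h | h
    · simp [← h]
    · exact (mul_pos h (hc w h)).le
  have hSneg : ∀ x c, S x (fun z ↦ - c z) = - S x c := fun x c ↦ by simp [S]
  have hSneg' : ∀ x : ℝ × ℝ, |x.1| < r + 2 → |x.2| < r + 2 → ∀ c : ℤ × ℤ → ℝ,
      (∀ z, 0 < φ (x - latticePoint z) → c z < 0) → S x c < 0 := by
    intro x h1 h2 c hc
    have := hSpos x h1 h2 (fun z ↦ - c z) fun z hz ↦ neg_pos.2 (hc z hz)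
    rw [hSneg] at this
    linarith
  have hSne : ∀ x : ℝ × ℝ, |x.1| < r + 2 → |x.2| < r + 2 → ∀ c : ℤ × ℤ → ℝ, ∀ n : ℤ,
      (∀ z, 0 < φ (x - latticePoint z) → c z = n - 1 / 2) → S x c ≠ 0 := by
    intro x h1 h2 c n hc
    rcases le_or_gt n 0 with hn | hn
    · refine (hSneg' x h1 h2 c fun z hz ↦ ?_).ne
      have : (n : ℝ) ≤ 0 := mod_cast hn
      rw [hc z hz]; linarith
    · refine (hSpos x h1 h2 c fun z hz ↦ ?_).ne'
      have : (1 : ℝ) ≤ n := mod_cast hn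
      rw [hc z hz]; linarith
  let c₁ : ℤ × ℤ → ℝ := fun z ↦ z.1 - 1 / 2
  let c₂ : ℤ × ℤ → ℝ := fun z ↦ z.2 - 1 / 2
  have hnear : ∀ x z, 0 < φ (x - latticePoint z) →
      |x.1 - z.1| ≤ r ∧ |x.2 - z.2| ≤ r := fun x z hz ↦ hbd _ ((hφpos _).1 hz)
  have hlt {t : ℝ} (ht : |t| ≤ r + 1) : |t| < r + 2 := by linarith
  have hN : |r + 1| < r + 2 := by rw [abs_of_pos] <;> linarith
  have hN' : |-(r + 1)| < r + 2 := by rwa [abs_neg]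
  obtain ⟨x, hx1, hx2, hx⟩ := exists_eq_zero_of_sides
    (g := fun x ↦ (⟨S x c₁, S x c₂⟩ : ℂ)) (N := r + 1) (M := r + 2)
    (Complex.equivRealProdCLM.symm.continuous.comp ((hSc c₁).prodMk (hSc c₂)))
    (by linarith) (by linarith)
    (fun y hy ↦ hSpos _ hN (hlt hy) _ fun z hz ↦ by
      have := abs_le.1 (hnear _ z hz).1
      simp only [c₁] at this ⊢
      linarith)
    (fun y hy ↦ hSneg' _ hN' (hlt hy) _ fun z hz ↦ by
      have := abs_le.1 (hnear _ z hz).1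
      simp only [c₁] at this ⊢
      linarith)
    (fun y hy ↦ hSpos _ (hlt hy) hN _ fun z hz ↦ by
      have := abs_le.1 (hnear _ z hz).2
      simp only [c₂] at this ⊢
      linarith)
    (fun y hy ↦ hSneg' _ (hlt hy) hN' _ fun z hz ↦ by
      have := abs_le.1 (hnear _ z hz).2
      simp only [c₂] at this ⊢
      linarith)
  obtain ⟨hx₁, hx₂⟩ := Complex.ext_iff.1 hx
  obtain ⟨z, -, hz⟩ := hcov' x hx1 hx2
  rcases fst_eq_or_snd_eq_of_sub_mem_cross (P := fun z ↦ 0 < φ (x - latticePoint z))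
    (fun z w hz hw ↦ (hdiff _).2 <| hεK _ _ ((hφpos _).1 hw) _ ((hφpos _).1 hz) (by
      ext <;> simp [latticePoint])) hz with h | h
  · exact hSne x hx1 hx2 c₁ z.1 (fun w hw ↦ by simp [c₁, h w hw]) hx₁
  · exact hSne x hx1 hx2 c₂ z.2 (fun w hw ↦ by simp [c₂, h w hw]) hx₂

/-- The set `A = {(-1,0), (0,-1), (0,0), (1,0), (0,1)} ⊆ ℤ²` is a finite
symmetric set of relatively prime lattice points containing 0, yet is not of the form
`(K - K) ∩ ℤ²` for any compact `K ⊆ ℝ²` with `K + ℤ² = ℝ²`. -/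
theorem cross_not_difference_set :
    (({(-1, 0), (0, -1), (0, 0), (1, 0), (0, 1)} : Set (ℤ × ℤ)).Finite ∧
      ({(-1, 0), (0, -1), (0, 0), (1, 0), (0, 1)} : Set (ℤ × ℤ)) =
        -({(-1, 0), (0, -1), (0, 0), (1, 0), (0, 1)} : Set (ℤ × ℤ)) ∧
      (0 : ℤ × ℤ) ∈ ({(-1, 0), (0, -1), (0, 0), (1, 0), (0, 1)} : Set (ℤ × ℤ)) ∧
      AddSubgroup.closure ({(-1, 0), (0, -1), (0, 0), (1, 0), (0, 1)} : Set (ℤ × ℤ)) = ⊤) ∧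
    ¬ ∃ K : Set (ℝ × ℝ), IsCompact K ∧
      (∀ x : ℝ × ℝ, ∃ y ∈ K, ∃ z : ℤ × ℤ, x = y + ((z.1 : ℝ), (z.2 : ℝ))) ∧
      (∀ z : ℤ × ℤ,
        z ∈ ({(-1, 0), (0, -1), (0, 0), (1, 0), (0, 1)} : Set (ℤ × ℤ)) ↔
          ((z.1 : ℝ), (z.2 : ℝ)) ∈ K - K) := by
  refine ⟨⟨Set.toFinite _, ?_, by simp [Prod.ext_iff], closure_cross⟩, not_exists_cross_cover⟩
  ext ⟨a, b⟩
  simp only [Set.mem_neg, Set.mem_insert_iff, Set.mem_singleton_iff, Prod.ext_iff, Prod.fst_neg,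
    Prod.snd_neg]
  omega
end

section
/- Let n ≥ 2, let T = ℝ^n/ℤ^n be the n-torus with quotient (covering) map p : ℝ^n → T, and let C ⊆ T be a compact connected set equal to the closure of its interior, whose interior is connected and whose topological boundary ∂C is the image of an injective continuous map s : S^{n−1} → T from the (n−1)-sphere. Assume that every loop contained in ∂C is null-homotopic in T. Then the image of the map π_1(C) → π_1(T) ≅ ℤ^n induced by the inclusion i : C → T is either the trivial subgroup or all of ℤ^n. -/
open Pointwise

open Set Topology

theorem continuousOn_indicator_of_frontier {X : Type*} [TopologicalSpace X] {s t : Set X}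
    {f : X → ℝ} (hf : Continuous f) (h : ∀ x ∈ s ∩ frontier t, f x = 0) :
    ContinuousOn (t.indicator f) s := by
  classical
  have := ContinuousOn.piecewise (s := s) (t := t) (f := f) (g := fun _ => (0 : ℝ)) h
    hf.continuousOn continuousOn_const
  exact (Set.piecewise_eq_indicator (s := t) (f := f)) ▸ this

/-- In a simply connected, locally path connected normal space, two connected open sets covering
the space have connected intersection. -/
theorem IsPreconnected.inter_of_union_eq_univ {X : Type*} [TopologicalSpace X] [NormalSpace X]
    [SimplyConnectedSpace X] [LocallyPathConnectedSpace X] {N M : Set X}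
    (hNo : IsOpen N) (hMo : IsOpen M) (hN : IsPreconnected N) (hM : IsPreconnected M)
    (hNM : N ∪ M = univ) : IsPreconnected (N ∩ M) := by
  intro U W hU hW hcov hneU hneW
  by_contra hdisj
  rw [Set.not_nonempty_iff_eq_empty] at hdisj
  obtain ⟨a, haNM, haU⟩ := hneU
  obtain ⟨b, hbNM, hbW⟩ := hneW
  set P : Set X := N ∩ M ∩ U with hP
  have hPo : IsOpen P := (hNo.inter hMo).inter hU
  have hbP : b ∉ P := fun hb => by
    have : b ∈ N ∩ M ∩ (U ∩ W) := ⟨hbNM, hb.2, hbW⟩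
    simp [hdisj] at this
  have hfr : ∀ x ∈ frontier P, x ∉ N ∩ M := by
    intro x hx hxNM
    rw [hPo.frontier_eq] at hx
    have hxU : x ∉ U := fun h => hx.2 ⟨hxNM, h⟩
    have hxW : x ∈ W := (hcov hxNM).resolve_left hxU
    obtain ⟨y, hyW, hyP⟩ := mem_closure_iff.1 hx.1 W hW hxW
    have : y ∈ N ∩ M ∩ (U ∩ W) := ⟨hyP.1, hyP.2, hyW⟩
    simp [hdisj] at this
  obtain ⟨u, hu0, hu1, -⟩ := exists_continuous_zero_one_of_isClosed hNo.isClosed_compl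
    hMo.isClosed_compl (by
      rw [Set.disjoint_compl_left_iff_subset]
      exact fun x hx => (hNM.ge (mem_univ x)).resolve_right hx)
  have hw₁ : ContinuousOn (P.indicator u) M :=
    continuousOn_indicator_of_frontier u.continuous fun x hx =>
      hu0 fun h => hfr x hx.2 ⟨h, hx.1⟩
  have hw₂ : ContinuousOn (P.indicator fun x => u x - 1) N :=
    continuousOn_indicator_of_frontier (u.continuous.sub continuous_const) fun x hx => by
      rw [hu1 (fun h => hfr x hx.2 ⟨hx.1, h⟩ : x ∈ Mᶜ)]; simp
  have hw : ∀ x, ((P.indicator (fun x => u x - 1) x : ℝ) : AddCircle (1 : ℝ)) =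
      (P.indicator u x : ℝ) := by
    intro x
    by_cases hx : x ∈ P <;> simp [hx]
  have hcoe : Continuous fun x : ℝ => (x : AddCircle (1 : ℝ)) := AddCircle.continuous_mk' 1
  have hg : Continuous fun x => ((P.indicator u x : ℝ) : AddCircle (1 : ℝ)) := by
    rw [← continuousOn_univ, ← hNM]
    refine ContinuousOn.union_of_isOpen ?_ (hcoe.comp_continuousOn hw₁) hNo hMo
    exact (hcoe.comp_continuousOn hw₂).congr fun x _ => (hw x).symm
  obtain ⟨h, ⟨-, hh⟩, -⟩ := (AddCircle.isCoveringMap_coe (1 : ℝ)).existsUnique_continuousMap_lifts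
    ⟨_, hg⟩ a _ rfl
  have hh : ∀ x, ((h x : ℝ) : AddCircle (1 : ℝ)) = (P.indicator u x : ℝ) := congr_fun hh
  have hZ : ∀ {x y : ℝ}, (x : AddCircle (1 : ℝ)) = y → x - y ∈ AddSubgroup.zmultiples (1 : ℝ) := by
    intro x y hxy
    rw [← AddSubgroup.neg_mem_iff, neg_sub, sub_eq_neg_add]
    exact QuotientAddGroup.eq.1 hxy
  have hD : IsDiscrete (AddSubgroup.zmultiples (1 : ℝ) : Set ℝ) :=
    ⟨inferInstanceAs (DiscreteTopology (AddSubgroup.zmultiples (1 : ℝ)))⟩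
  have key₁ := hM.constant_of_mapsTo (T := (AddSubgroup.zmultiples (1 : ℝ) : Set ℝ))
    hD (f := fun x => h x - P.indicator u x) (h.continuous.continuousOn.sub hw₁)
    (fun x _ => hZ (hh x)) haNM.2 hbNM.2
  have key₂ := hN.constant_of_mapsTo (T := (AddSubgroup.zmultiples (1 : ℝ) : Set ℝ))
    hD (f := fun x => h x - P.indicator (fun x => u x - 1) x) (h.continuous.continuousOn.sub hw₂)
    (fun x _ => hZ ((hh x).trans (hw x).symm)) haNM.1 hbNM.1
  have haP : a ∈ P := ⟨haNM, haU⟩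
  simp only [indicator_of_mem haP, indicator_of_notMem hbP] at key₁ key₂
  linarith

/-- A locally finite disjoint union of connected closed sets, none of which separates a simply
connected space, does not separate it either. -/
theorem isPreconnected_compl_iUnion {X ι : Type*} [TopologicalSpace X] [NormalSpace X]
    [SimplyConnectedSpace X] [LocallyPathConnectedSpace X] {B : ι → Set X}
    (hlf : LocallyFinite B) (hcl : ∀ i, IsClosed (B i)) (hB : ∀ i, IsConnected (B i))
    (hBc : ∀ i, IsPreconnected (B i)ᶜ) (hdisj : Pairwise fun i j => Disjoint (B i) (B j)) :
    IsPreconnected (⋃ i, B i)ᶜ := by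
  have hN : ∀ i, ∃ N, IsOpen N ∧ IsPreconnected N ∧ B i ⊆ N ∧ ∀ j, j ≠ i → Disjoint (B j) N := by
    intro i
    obtain ⟨x, hx⟩ := (hB i).nonempty
    have hF : IsClosed (⋃ j : {j // j ≠ i}, B j) :=
      (hlf.comp_injective Subtype.val_injective).isClosed_iUnion fun j => hcl j
    have hBF : B i ⊆ (⋃ j : {j // j ≠ i}, B j)ᶜ := by
      intro y hy hy'
      obtain ⟨⟨j, hj⟩, hyj⟩ := mem_iUnion.1 hy'
      exact disjoint_left.1 (hdisj hj) hyj hy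
    refine ⟨connectedComponentIn (⋃ j : {j // j ≠ i}, B j)ᶜ x, hF.isOpen_compl.connectedComponentIn,
      isPreconnected_connectedComponentIn, (hB i).isPreconnected.subset_connectedComponentIn hx hBF,
      fun j hj => ?_⟩
    rw [disjoint_left]
    exact fun y hy hy' => connectedComponentIn_subset _ _ hy' (mem_iUnion.2 ⟨⟨j, hj⟩, hy⟩)
  choose N hNo hNc hBN hNd using hN
  have hpre : ∀ i, IsPreconnected (N i \ B i) := fun i => by
    refine IsPreconnected.inter_of_union_eq_univ (hNo i) (hcl i).isOpen_compl (hNc i) (hBc i) ?_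
    rw [eq_univ_iff_forall]
    exact fun x => (em (x ∈ B i)).imp (fun h => hBN i h) id
  have hsub : ∀ i, N i \ B i ⊆ (⋃ i, B i)ᶜ := by
    intro i x hx hx'
    obtain ⟨j, hj⟩ := mem_iUnion.1 hx'
    rcases eq_or_ne j i with rfl | hji
    · exact hx.2 hj
    · exact disjoint_left.1 (hNd i j hji) hj hx.1
  have hEo : IsOpen (⋃ i, B i)ᶜ := (hlf.isClosed_iUnion hcl).isOpen_compl
  intro U W hU hW hcov hneU hneW
  by_contra hdisjUW
  rw [Set.not_nonempty_iff_eq_empty] at hdisjUW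
  set E := (⋃ i, B i)ᶜ with hE
  have hBE : ∀ i, ∀ x ∈ B i, x ∉ E := fun i x hx hxE => hxE (mem_iUnion.2 ⟨i, hx⟩)
  have hUW : ∀ x ∈ E, x ∈ U → x ∈ W → False := fun x hE hU hW => by
    have : x ∈ E ∩ (U ∩ W) := ⟨hE, hU, hW⟩
    simp [hdisjUW] at this
  have hdich : ∀ i, N i \ B i ⊆ U ∨ N i \ B i ⊆ W := by
    intro i
    refine (isPreconnected_iff_subset_of_disjoint.1 (hpre i)) U W hU hW ((hsub i).trans hcov) ?_
    rw [eq_empty_iff_forall_notMem]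
    exact fun x hx => hUW x (hsub i hx.1) hx.2.1 hx.2.2
  set P := (E ∩ U) ∪ ⋃ i : {i // N i \ B i ⊆ U}, N i with hP
  set Q := (E ∩ W) ∪ ⋃ i : {i // ¬ N i \ B i ⊆ U}, N i with hQ
  have hPo : IsOpen P := (hEo.inter hU).union (isOpen_iUnion fun i => hNo i)
  have hQo : IsOpen Q := (hEo.inter hW).union (isOpen_iUnion fun i => hNo i)
  have hPQ : univ ⊆ P ∪ Q := by
    intro x _
    by_cases hx : x ∈ E
    · exact (hcov hx).imp (fun h => Or.inl ⟨hx, h⟩) fun h => Or.inl ⟨hx, h⟩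
    · obtain ⟨i, hi⟩ := mem_iUnion.1 (not_not.1 hx)
      by_cases hiU : N i \ B i ⊆ U
      · exact Or.inl (Or.inr (mem_iUnion.2 ⟨⟨i, hiU⟩, hBN i hi⟩))
      · exact Or.inr (Or.inr (mem_iUnion.2 ⟨⟨i, hiU⟩, hBN i hi⟩))
  obtain ⟨x, -, hxP, hxQ⟩ := isPreconnected_univ P Q hPo hQo hPQ
    (hneU.mono fun x hx => ⟨mem_univ x, Or.inl hx⟩) (hneW.mono fun x hx => ⟨mem_univ x, Or.inl hx⟩)
  rcases hxP with ⟨hxE, hxU⟩ | hxP <;> rcases hxQ with ⟨hxE', hxW⟩ | hxQ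
  · exact hUW x hxE hxU hxW
  · obtain ⟨⟨i, hi⟩, hxi⟩ := mem_iUnion.1 hxQ
    exact hUW x hxE hxU ((hdich i).resolve_left hi ⟨hxi, fun h => hBE i x h hxE⟩)
  · obtain ⟨⟨i, hi⟩, hxi⟩ := mem_iUnion.1 hxP
    exact hUW x hxE' (hi ⟨hxi, fun h => hBE i x h hxE'⟩) hxW
  · obtain ⟨⟨i, hi⟩, hxi⟩ := mem_iUnion.1 hxP
    obtain ⟨⟨j, hj⟩, hxj⟩ := mem_iUnion.1 hxQ
    have hij : i ≠ j := by rintro rfl; exact hj hi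
    have hxi' : x ∈ N i \ B i := ⟨hxi, fun h => disjoint_left.1 (hNd j i hij) h hxj⟩
    have hxj' : x ∈ N j \ B j := ⟨hxj, fun h => disjoint_left.1 (hNd i j hij.symm) h hxi⟩
    exact hUW x (hsub i hxi') (hi hxi') ((hdich j).resolve_left hj hxj')

theorem isPreconnected_compl_closedBall {V : Type*} [NormedAddCommGroup V] [NormedSpace ℝ V]
    (hV : 1 < Module.rank ℝ V) {R : ℝ} (hR : 0 ≤ R) :
    IsPreconnected (Metric.closedBall (0 : V) R)ᶜ := by
  have h : (Metric.closedBall (0 : V) R)ᶜ =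
      (fun q : ℝ × V => q.1 • q.2) '' (Ioi R ×ˢ Metric.sphere 0 1) := by
    ext x
    simp only [mem_compl_iff, Metric.mem_closedBall, dist_zero_right, not_le, mem_image, mem_prod,
      mem_Ioi, mem_sphere_iff_norm, sub_zero, Prod.exists]
    constructor
    · intro hx
      have hx0 : ‖x‖ ≠ 0 := (hR.trans_lt hx).ne'
      refine ⟨‖x‖, ‖x‖⁻¹ • x, ⟨hx, ?_⟩, ?_⟩
      · rw [norm_smul, norm_inv, norm_norm, inv_mul_cancel₀ hx0]
      · rw [smul_smul, mul_inv_cancel₀ hx0, one_smul]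
    · rintro ⟨r, v, ⟨hr, hv⟩, rfl⟩
      rw [norm_smul, hv, mul_one, Real.norm_eq_abs]
      exact hr.trans_le (le_abs_self r)
  rw [h]
  exact (isPreconnected_Ioi.prod (isPreconnected_sphere hV 0 1)).image _
    (continuous_fst.smul continuous_snd).continuousOn

theorem not_vadd_subset_of_isBounded {V : Type*} [NormedAddCommGroup V] [NormedSpace ℝ V]
    {B : Set V} (hB : Bornology.IsBounded B) (hne : B.Nonempty) {k : V} (hk : k ≠ 0) :
    ¬ k +ᵥ B ⊆ B := by
  intro hsub
  obtain ⟨x, hx⟩ := hne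
  have hmem : ∀ j : ℕ, (j : ℝ) • k + x ∈ B := by
    intro j
    induction j with
    | zero => simpa using hx
    | succ j ih =>
      have := hsub (Set.vadd_mem_vadd_set (a := k) ih)
      convert this using 1
      rw [vadd_eq_add]; push_cast; module
  obtain ⟨R, hR⟩ := hB.exists_norm_le
  obtain ⟨j, hj⟩ := exists_nat_gt ((R + ‖x‖) / ‖k‖)
  rw [div_lt_iff₀ (norm_pos_iff.2 hk)] at hj
  have h₁ := hR _ (hmem j)
  have h₂ := norm_sub_le ((j : ℝ) • k + x) x
  rw [add_sub_cancel_right, norm_smul, Real.norm_natCast] at h₂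
  linarith

/-- Filling in the bounded complementary components of a compact connected set `S` gives a compact
connected set with connected complement; translates of it are disjoint from it as soon as the
corresponding translates of `S` are disjoint from `S`. -/
theorem exists_hull {V : Type*} [NormedAddCommGroup V] [NormedSpace ℝ V] [ProperSpace V]
    (hV : 1 < Module.rank ℝ V) {S : Set V} (hS : IsCompact S) (hSc : IsConnected S) :
    ∃ B : Set V, IsCompact B ∧ IsConnected B ∧ IsPreconnected Bᶜ ∧ S ⊆ B ∧
      ∀ k : V, k ≠ 0 → Disjoint (k +ᵥ S) S → Disjoint (k +ᵥ B) B := by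
  have : Nontrivial V := by
    by_contra h
    rw [not_nontrivial_iff_subsingleton] at h
    rw [rank_subsingleton'] at hV
    exact absurd hV (by simp)
  obtain ⟨R, hR0, hR⟩ := hS.isBounded.exists_pos_norm_le
  have hfar : (Metric.closedBall (0 : V) R)ᶜ ⊆ Sᶜ :=
    compl_subset_compl.2 fun x hx => by simpa using hR x hx
  obtain ⟨y, hy⟩ := NormedSpace.exists_lt_norm ℝ V R
  have hy' : y ∈ (Metric.closedBall (0 : V) R)ᶜ := by simpa using hy
  set E := connectedComponentIn Sᶜ y with hE
  have hEo : IsOpen E := hS.isClosed.isOpen_compl.connectedComponentIn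
  have hEc : IsPreconnected E := isPreconnected_connectedComponentIn
  have hES : E ⊆ Sᶜ := connectedComponentIn_subset _ _
  have hEfar : (Metric.closedBall (0 : V) R)ᶜ ⊆ E :=
    (isPreconnected_compl_closedBall hV hR0.le).subset_connectedComponentIn hy' hfar
  have hEmax : ∀ A : Set V, IsPreconnected A → A ⊆ Sᶜ → (A ∩ E).Nonempty → A ⊆ E := by
    rintro A hA hAS ⟨x, hxA, hxE⟩
    rw [hE, connectedComponentIn_eq hxE]
    exact hA.subset_connectedComponentIn hxA hAS
  have hBS : S ⊆ Eᶜ := subset_compl_comm.1 hES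
  have hBb : Eᶜ ⊆ Metric.closedBall (0 : V) R := compl_subset_comm.1 hEfar
  have hBcpt : IsCompact Eᶜ :=
    (isCompact_closedBall (0 : V) R).of_isClosed_subset hEo.isClosed_compl hBb
  obtain ⟨z, hz⟩ := hSc.nonempty
  have hBc : IsPreconnected Eᶜ := by
    refine isPreconnected_of_forall z fun x hx => ?_
    by_cases hxS : x ∈ S
    · exact ⟨S, hBS, hz, hxS, hSc.isPreconnected⟩
    set W := connectedComponentIn Sᶜ x with hW
    have hxW : x ∈ W := mem_connectedComponentIn hxS
    have hWE : Disjoint W E := by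
      rw [Set.disjoint_iff_inter_eq_empty, ← Set.not_nonempty_iff_eq_empty]
      intro h
      exact hx (hEmax W isPreconnected_connectedComponentIn (connectedComponentIn_subset _ _) h hxW)
    have hWc : IsPreconnected (closure W) := isPreconnected_connectedComponentIn.closure
    have hclW : closure W ⊆ Eᶜ := closure_minimal hWE.subset_compl_right hEo.isClosed_compl
    have hmeet : (closure W ∩ S).Nonempty := by
      by_contra h
      have hsub : closure W ⊆ W := hWc.subset_connectedComponentIn (subset_closure hxW)
        fun a ha haS => h ⟨a, ha, haS⟩
      have hclopen : IsClopen W :=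
        ⟨closure_subset_iff_isClosed.1 hsub, hS.isClosed.isOpen_compl.connectedComponentIn⟩
      have := hclopen.eq_univ ⟨x, hxW⟩
      exact (connectedComponentIn_subset _ _ (this.ge (mem_univ z)) : z ∈ Sᶜ) hz
    obtain ⟨w, hwW, hwS⟩ := hmeet
    exact ⟨closure W ∪ S, union_subset hclW hBS, Or.inr hz, Or.inl (subset_closure hxW),
      hWc.union w hwW hwS hSc.isPreconnected⟩
  refine ⟨Eᶜ, hBcpt, ⟨⟨z, hBS hz⟩, hBc⟩, by rwa [compl_compl], hBS, ?_⟩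
  have hvc : ∀ (k : V) {A : Set V}, IsPreconnected A → IsPreconnected (k +ᵥ A) := fun k A hA =>
    hA.image _ (continuous_const_vadd k).continuousOn
  have key : ∀ k : V, k ≠ 0 → Disjoint (k +ᵥ S) S → k +ᵥ S ⊆ E := by
    intro k hk hd
    by_contra hnot
    have hkE : k +ᵥ S ⊆ Eᶜ := by
      intro x hx hxE
      exact hnot (hEmax _ (hvc k hSc.isPreconnected) hd.subset_compl_right ⟨x, hx, hxE⟩)
    have hsub : (-k) +ᵥ E ⊆ E := by
      refine hEmax _ (hvc _ hEc) ?_ ?_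
      · rintro _ ⟨x, hx, rfl⟩ hxS
        have := hkE (Set.vadd_mem_vadd_set (a := k) hxS)
        simp only [vadd_eq_add, add_neg_cancel_left] at this
        exact this hx
      · obtain ⟨w, hw⟩ := NormedSpace.exists_lt_norm ℝ V (R + ‖k‖)
        refine ⟨(-k) +ᵥ w, Set.vadd_mem_vadd_set (hEfar ?_), hEfar ?_⟩
        · have := norm_nonneg k
          simp; linarith
        · have := norm_sub_norm_le w k
          simp only [vadd_eq_add, mem_compl_iff, Metric.mem_closedBall, dist_zero_right, not_le]
          rw [neg_add_eq_sub]
          linarith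
    refine not_vadd_subset_of_isBounded hBcpt.isBounded ⟨z, hBS hz⟩ hk ?_
    rintro _ ⟨x, hx, rfl⟩ hxE
    have := hsub (Set.vadd_mem_vadd_set (a := -k) hxE)
    simp only [vadd_eq_add, neg_add_cancel_left] at this
    exact hx this
  intro k hk hd
  have h₁ := key k hk hd
  have hd' : Disjoint ((-k) +ᵥ S) S := by
    rw [Set.disjoint_left]
    rintro _ ⟨x, hx, rfl⟩ hxS
    have := Set.vadd_mem_vadd_set (a := k) hxS
    simp only [vadd_eq_add, add_neg_cancel_left] at this
    exact Set.disjoint_left.1 hd this hx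
  have h₂ := key (-k) (neg_ne_zero.2 hk) hd'
  have : k +ᵥ Eᶜ ⊆ E := by
    refine hEmax _ (hvc k hBc) ?_ ⟨k +ᵥ z, Set.vadd_mem_vadd_set (hBS hz),
      h₁ (Set.vadd_mem_vadd_set hz)⟩
    rintro _ ⟨x, hx, rfl⟩ hxS
    have := h₂ (Set.vadd_mem_vadd_set (a := -k) hxS)
    simp only [vadd_eq_add, neg_add_cancel_left] at this
    exact hx this
  exact Set.disjoint_left.2 fun x hx hx' => hx' (this hx)

theorem IsPreconnected.subset_of_subset_iUnion_of_locallyFinite {X ι : Type*} [TopologicalSpace X]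
    {B : ι → Set X} (hlf : LocallyFinite B) (hcl : ∀ i, IsClosed (B i))
    (hdisj : Pairwise fun i j => Disjoint (B i) (B j)) {A : Set X} (hA : IsPreconnected A)
    (hAB : A ⊆ ⋃ i, B i) {i : ι} (hi : (A ∩ B i).Nonempty) : A ⊆ B i := by
  have hF : IsClosed (⋃ j : {j // j ≠ i}, B j) :=
    (hlf.comp_injective Subtype.val_injective).isClosed_iUnion fun j => hcl j
  have hd : Disjoint (B i) (⋃ j : {j // j ≠ i}, B j) :=
    disjoint_iUnion_right.2 fun j => hdisj j.2.symm
  refine ((isPreconnected_iff_subset_of_disjoint_closed.1 hA) _ _ (hcl i) hF ?_ ?_).resolve_right ?_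
  · intro x hx
    obtain ⟨j, hj⟩ := mem_iUnion.1 (hAB hx)
    rcases eq_or_ne j i with rfl | hji
    · exact Or.inl hj
    · exact Or.inr (mem_iUnion.2 ⟨⟨j, hji⟩, hj⟩)
  · rw [hd.inter_eq, inter_empty]
  · intro h
    obtain ⟨x, hx, hxi⟩ := hi
    exact disjoint_left.1 hd hxi (h hx)

open FundamentalGroup in
theorem IsCoveringMap.exists_continuousMap_lift_of_nullhomotopic {E X A : Type*}
    [TopologicalSpace E] [TopologicalSpace X] [TopologicalSpace A] [PathConnectedSpace A]
    [LocallyPathConnectedSpace A] {p : E → X} (cov : IsCoveringMap p)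
    (hp : Function.Surjective p) (f : C(A, X))
    (hf : ∀ (a : A) (γ : Path a a), (γ.map f.continuous).Homotopic (Path.refl (f a))) :
    ∃ F : C(A, E), ∀ a, p (F a) = f a := by
  obtain ⟨a₀⟩ := (inferInstance : Nonempty A)
  obtain ⟨e₀, he⟩ := hp (f a₀)
  obtain ⟨F, ⟨-, hF⟩, -⟩ := cov.existsUnique_continuousMap_lifts_of_range_le he (by
    rintro _ ⟨⟨γ⟩, rfl⟩
    refine (congrArg (· ∈ _) ?_).mpr (one_mem (mapOfEq ⟨p, cov.continuous⟩ he).range)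
    exact Path.Homotopic.Quotient.eq.2 (hf a₀ γ))
  exact ⟨F, congr_fun hF⟩

theorem Path.homotopic_of_lifts {E X : Type*} [TopologicalSpace E] [TopologicalSpace X]
    [SimplyConnectedSpace E] {p : E → X} (hp : Continuous p) {a b : E} (Γ Δ : Path a b)
    {x y : X} {γ δ : Path x y} (hγ : ∀ t, p (Γ t) = γ t) (hδ : ∀ t, p (Δ t) = δ t) :
    γ.Homotopic δ := by
  have hx : x = p a := by rw [← Γ.source, hγ, γ.source]
  have hy : y = p b := by rw [← Γ.target, hγ, γ.target]
  subst hx hy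
  have h₁ : γ = Γ.map hp := Path.ext (funext fun t => (hγ t).symm)
  have h₂ : δ = Δ.map hp := Path.ext (funext fun t => (hδ t).symm)
  rw [h₁, h₂]
  exact (SimplyConnectedSpace.paths_homotopic Γ Δ).map ⟨p, hp⟩

/-- A closed set with path connected interior and frontier is path connected, provided the
ambient space is the continuous image of a normed space. -/
theorem isPathConnected_of_interior_of_frontier {V X : Type*} [NormedAddCommGroup V]
    [NormedSpace ℝ V] [ProperSpace V] [TopologicalSpace X] {p : V → X} (hp : Continuous p)
    (hsurj : Function.Surjective p) {C : Set X} (hC : IsClosed C)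
    (h_int : IsPathConnected (interior C)) (hfr : IsPathConnected (frontier C)) :
    IsPathConnected C := by
  obtain ⟨x, hx⟩ := h_int.nonempty
  obtain ⟨u, rfl⟩ := hsurj x
  have hne : (p ⁻¹' frontier C).Nonempty := hfr.nonempty.preimage hsurj
  have hFcl : IsClosed (p ⁻¹' frontier C) := isClosed_frontier.preimage hp
  obtain ⟨z, hz, hzd⟩ := hFcl.exists_infDist_eq_dist hne u
  have huF : u ∉ p ⁻¹' frontier C := fun h => h.2 hx
  have hr : 0 < dist u z := by
    rw [← hzd]; exact (hFcl.notMem_iff_infDist_pos hne).1 huF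
  have hball : Metric.ball u (dist u z) ⊆ p ⁻¹' interior C := by
    refine IsPreconnected.subset_left_of_subset_union (isOpen_interior.preimage hp)
      (hC.isOpen_compl.preimage hp) ?_ ?_ ⟨u, Metric.mem_ball_self hr, hx⟩
      Metric.isPreconnected_ball
    · exact Disjoint.preimage p (disjoint_compl_right.mono_left interior_subset)
    · intro y hy
      by_contra hcon
      simp only [mem_union, mem_preimage, mem_compl_iff, not_or, not_not] at hcon
      have hyF : y ∈ p ⁻¹' frontier C := ⟨subset_closure hcon.2, hcon.1⟩
      have := Metric.infDist_le_dist_of_mem (x := u) hyF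
      rw [hzd, dist_comm u y] at this
      exact absurd (Metric.mem_ball.1 hy) (not_lt.2 this)
  have hcball : Metric.closedBall u (dist u z) ⊆ p ⁻¹' C := by
    rw [← closure_ball u hr.ne']
    exact closure_minimal (hball.trans (preimage_mono interior_subset)) (hC.preimage hp)
  have hseg : segment ℝ u z ⊆ p ⁻¹' C :=
    ((convex_closedBall u (dist u z)).segment_subset (Metric.mem_closedBall_self hr.le)
      (Metric.mem_closedBall.2 (dist_comm z u).le)).trans hcball
  have huz : JoinedIn C (p u) (p z) :=
    ((JoinedIn.of_segment_subset hseg).map hp).mono (image_preimage_subset p C)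
  refine ⟨p u, interior_subset hx, fun {y} hy => ?_⟩
  by_cases hyi : y ∈ interior C
  · exact (h_int.joinedIn _ hx _ hyi).mono interior_subset
  · exact huz.trans ((hfr.joinedIn _ hz _ ⟨subset_closure hy, hyi⟩).mono hC.frontier_subset)

/-- The covering map from Euclidean space to the torus. -/
def torusProj (n : ℕ) : (Fin n → ℝ) →+ (Fin n → AddCircle (1 : ℝ)) where
  toFun x i := x i
  map_zero' := rfl
  map_add' _ _ := rfl

/-- An integer vector as a real vector. -/
def intVector {n : ℕ} (k : Fin n → ℤ) : Fin n → ℝ := fun i => k i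

theorem torusProj_eq_zero_iff {n : ℕ} {x : Fin n → ℝ} :
    torusProj n x = 0 ↔ ∃ k, intVector k = x := by
  constructor
  · intro h
    choose k hk using fun i => (AddCircle.coe_eq_zero_iff (1 : ℝ)).1 (congr_fun h i)
    exact ⟨k, funext fun i => by simpa [intVector] using hk i⟩
  · rintro ⟨k, rfl⟩
    exact funext fun i => (AddCircle.coe_eq_zero_iff (1 : ℝ)).2 ⟨k i, by simp [intVector]⟩

theorem torusProj_eq_iff {n : ℕ} {x y : Fin n → ℝ} :
    torusProj n x = torusProj n y ↔ ∃ k, x = intVector k + y := by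
  rw [← sub_eq_zero, ← map_sub, torusProj_eq_zero_iff]
  simp only [eq_sub_iff_add_eq, eq_comm]

theorem isOpenQuotientMap_torusProj (n : ℕ) : IsOpenQuotientMap (torusProj n) :=
  IsOpenQuotientMap.piMap fun _ => QuotientAddGroup.isOpenQuotientMap_mk

theorem isCoveringMap_torusProj (n : ℕ) : IsCoveringMap (torusProj n) := by
  refine ((isOpenQuotientMap_torusProj n).isQuotientMap
    |>.isAddQuotientCoveringMap_of_isDiscrete_ker_addMonoidHom ?_).isCoveringMap
  have : ((torusProj n).ker : Set (Fin n → ℝ)) = range (intVector (n := n)) := by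
    ext x
    exact torusProj_eq_zero_iff
  rw [this]
  exact (IsEmbedding.piMap fun _ : Fin n =>
    Int.isClosedEmbedding_coe_real.isEmbedding).isDiscrete_range

theorem locallyFinite_intVector_vadd {n : ℕ} {B : Set (Fin n → ℝ)} (hB : Bornology.IsBounded B) :
    LocallyFinite fun k : Fin n → ℤ => intVector k +ᵥ B := by
  intro x
  obtain ⟨R, hR⟩ := hB.exists_norm_le
  refine ⟨Metric.ball x 1, Metric.ball_mem_nhds x one_pos, ?_⟩
  refine (Set.finite_Icc (fun _ => -⌈‖x‖ + 1 + R⌉) fun _ => ⌈‖x‖ + 1 + R⌉).subset ?_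
  rintro k ⟨_, ⟨b, hb, rfl⟩, hx⟩
  have h₁ := hR b hb
  have h₂ : ‖intVector k‖ ≤ ‖x‖ + 1 + R := by
    replace hx : ‖intVector k + b - x‖ < 1 := by rwa [Metric.mem_ball, dist_eq_norm] at hx
    have h₃ : intVector k = (intVector k + b - x) + x - b := by abel
    rw [h₃]
    refine (norm_sub_le _ _).trans (add_le_add ((norm_add_le _ _).trans ?_) h₁)
    linarith
  have h₄ : ∀ i, |k i| ≤ ⌈‖x‖ + 1 + R⌉ := by
    intro i
    have := (norm_le_pi_norm (intVector k) i).trans (h₂.trans (Int.le_ceil _))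
    rw [intVector, Real.norm_eq_abs] at this
    exact_mod_cast this
  exact ⟨fun i => (abs_le.1 (h₄ i)).1, fun i => (abs_le.1 (h₄ i)).2⟩

theorem pathConnectedSpace_sphere {n : ℕ} (hn : 2 ≤ n) :
    PathConnectedSpace (Metric.sphere (0 : EuclideanSpace ℝ (Fin n)) 1) := by
  rw [← isPathConnected_iff_pathConnectedSpace]
  refine isPathConnected_sphere ?_ 0 zero_le_one
  exact Module.lt_rank_of_lt_finrank (by rw [finrank_euclideanSpace_fin]; omega)

theorem locallyPathConnectedSpace_sphere {n : ℕ} (hn : 2 ≤ n) :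
    LocallyPathConnectedSpace (Metric.sphere (0 : EuclideanSpace ℝ (Fin n)) 1) := by
  have : Fact (Module.finrank ℝ (EuclideanSpace ℝ (Fin n)) = (n - 1) + 1) :=
    ⟨by rw [finrank_euclideanSpace_fin]; omega⟩
  exact ChartedSpace.locallyPathConnectedSpace (EuclideanSpace ℝ (Fin (n - 1))) _

theorem IsCoveringMap.exists_joinedIn_preimage {E X : Type*} [TopologicalSpace E]
    [TopologicalSpace X] {p : E → X} (cov : IsCoveringMap p) {C : Set X} {e : E} {y : X}
    (h : JoinedIn C (p e) y) : ∃ w, p w = y ∧ JoinedIn (p ⁻¹' C) e w := by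
  obtain ⟨α, hα⟩ := h
  obtain ⟨Γ, hΓ, hΓ0⟩ := cov.exists_path_lifts α e α.source
  have hΓ : ∀ t, p (Γ t) = α t := congr_fun hΓ
  exact ⟨Γ 1, (hΓ 1).trans α.target, ⟨Γ, hΓ0, rfl⟩, fun t => by
    rw [mem_preimage]; exact (hΓ t).symm ▸ hα t⟩

theorem IsCoveringMap.exists_lift_path {E X : Type*} [TopologicalSpace E]
    [TopologicalSpace X] {p : E → X} (cov : IsCoveringMap p) {e : E} {y : X}
    (γ : Path (p e) y) : ∃ (w : E) (Γ : Path e w), ∀ t, p (Γ t) = γ t := by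
  obtain ⟨Γ, hΓ, hΓ0⟩ := cov.exists_path_lifts γ e γ.source
  exact ⟨Γ 1, ⟨Γ, hΓ0, rfl⟩, congr_fun hΓ⟩

/-- The preimage in `ℝⁿ` of an embedded sphere in the torus whose loops are null-homotopic is covered
by disjoint integer translates of a compact connected set with connected complement. -/
theorem exists_disjoint_hulls {n : ℕ} (hn : 2 ≤ n)
    (s : Metric.sphere (0 : EuclideanSpace ℝ (Fin n)) 1 → (Fin n → AddCircle (1 : ℝ)))
    (hs_cont : Continuous s) (hs_inj : Function.Injective s)
    (hnull : ∀ (x : Fin n → AddCircle (1 : ℝ)) (γ : Path x x),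
      Set.range γ ⊆ range s → γ.Homotopic (Path.refl x)) :
    ∃ B : Set (Fin n → ℝ), IsCompact B ∧ IsConnected B ∧ IsPreconnected Bᶜ ∧
      (Pairwise fun k l : Fin n → ℤ => Disjoint (intVector k +ᵥ B) (intVector l +ᵥ B)) ∧
      torusProj n ⁻¹' range s ⊆ ⋃ k : Fin n → ℤ, intVector k +ᵥ B := by
  have := pathConnectedSpace_sphere hn
  have := locallyPathConnectedSpace_sphere hn
  obtain ⟨F, hF⟩ := (isCoveringMap_torusProj n).exists_continuousMap_lift_of_nullhomotopic
    (isOpenQuotientMap_torusProj n).surjective ⟨s, hs_cont⟩ fun a γ =>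
      hnull _ _ (by rintro _ ⟨t, rfl⟩; exact ⟨γ t, rfl⟩)
  have hF : ∀ a, torusProj n (F a) = s a := hF
  have hV : 1 < Module.rank ℝ (Fin n → ℝ) :=
    Module.lt_rank_of_lt_finrank (by rw [Module.finrank_fin_fun]; omega)
  obtain ⟨B, hB, hBc, hBcc, hSB, hBd⟩ := exists_hull hV (isCompact_range F.continuous)
    (isConnected_range F.continuous)
  have hd : ∀ k : Fin n → ℤ, k ≠ 0 → Disjoint (intVector k +ᵥ B) B := by
    intro k hk
    have hk' : intVector k ≠ 0 := fun h => hk <| funext fun i => by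
      simpa [intVector] using congr_fun h i
    refine hBd _ hk' (Set.disjoint_left.2 ?_)
    rintro _ ⟨_, ⟨a, rfl⟩, rfl⟩ ⟨b, hb⟩
    have hb : F b = intVector k + F a := hb
    have hab : s b = s a := by
      rw [← hF, ← hF]
      exact torusProj_eq_iff.2 ⟨k, hb⟩
    rw [hs_inj hab] at hb
    exact hk' (by simpa using hb)
  refine ⟨B, hB, hBc, hBcc, fun k l hkl => ?_, ?_⟩
  · have h := hd (k - l) (sub_ne_zero.2 hkl)
    have hkl' : intVector k +ᵥ B = intVector l +ᵥ (intVector (k - l) +ᵥ B) := by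
      rw [vadd_vadd]
      congr 1
      ext i
      simp [intVector]
    change Disjoint (intVector k +ᵥ B) (intVector l +ᵥ B)
    rw [hkl']
    exact (Set.disjoint_image_iff (add_right_injective (intVector l))).2 h
  · rintro x ⟨a, ha⟩
    rw [← hF] at ha
    obtain ⟨k, rfl⟩ := torusProj_eq_iff.1 ha.symm
    exact mem_iUnion.2 ⟨k, Set.vadd_mem_vadd_set (hSB ⟨a, rfl⟩)⟩

/-- Let `T = ℝⁿ/ℤⁿ` (n ≥ 2) and let `C ⊆ T` be compact, connected, equal to
the closure of its interior, with connected interior, whose topological boundary is the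
image of an injective continuous map from the sphere `S^{n-1}`, all of whose loops are
null-homotopic in `T`.  Then the image of `π₁(C) → π₁(T) ≅ ℤⁿ` induced by the inclusion
is trivial or all of `ℤⁿ`: at any basepoint of `C`, either every loop in `C` is
null-homotopic in `T`, or every loop of `T` is homotopic in `T` to a loop lying in `C`. -/
theorem component_pi1_image_trivial_or_full (n : ℕ) (hn : 2 ≤ n)
    (C : Set (Fin n → AddCircle (1 : ℝ)))
    (hCcpt : IsCompact C) (hCconn : IsConnected C)
    (hCcl : C = closure (interior C)) (hCint : IsConnected (interior C))
    (s : Metric.sphere (0 : EuclideanSpace ℝ (Fin n)) 1 → (Fin n → AddCircle (1 : ℝ)))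
    (hs_cont : Continuous s) (hs_inj : Function.Injective s)
    (hbd : frontier C = Set.range s)
    (hnull : ∀ (x : Fin n → AddCircle (1 : ℝ)) (γ : Path x x),
      Set.range γ ⊆ frontier C → γ.Homotopic (Path.refl x)) :
    ∀ x₀ ∈ C,
      (∀ γ : Path x₀ x₀, Set.range γ ⊆ C → γ.Homotopic (Path.refl x₀)) ∨
      (∀ δ : Path x₀ x₀, ∃ γ : Path x₀ x₀, Set.range γ ⊆ C ∧ γ.Homotopic δ) := by
  intro x₀ hx₀
  have hsurj := (isOpenQuotientMap_torusProj n).surjective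
  have cov := isCoveringMap_torusProj n
  have : LocallyPathConnectedSpace (Fin n → AddCircle (1 : ℝ)) :=
    (isOpenQuotientMap_torusProj n).isQuotientMap.locallyPathConnectedSpace
  obtain ⟨e₀, rfl⟩ := hsurj x₀
  have hCclosed : IsClosed C := hCcpt.isClosed
  obtain ⟨B, hBcpt, hBconn, hBcompl, hBdisj, hBcov⟩ := exists_disjoint_hulls hn s hs_cont hs_inj
    (hbd ▸ hnull)
  rw [← hbd] at hBcov
  have hlf := locallyFinite_intVector_vadd hBcpt.isBounded
  have hcl : ∀ k : Fin n → ℤ, IsClosed (intVector k +ᵥ B) := fun k => hBcpt.isClosed.vadd _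
  set F := ⋃ k : Fin n → ℤ, intVector k +ᵥ B with hFdef
  have hFc : IsPreconnected Fᶜ := by
    refine isPreconnected_compl_iUnion hlf hcl
      (fun k => hBconn.image _ (continuous_const_vadd _).continuousOn) (fun k => ?_) hBdisj
    rw [← Set.vadd_set_compl]
    exact hBcompl.image _ (continuous_const_vadd _).continuousOn
  have hFo : IsOpen Fᶜ := (hlf.isClosed_iUnion hcl).isOpen_compl
  have hFinv : ∀ (k : Fin n → ℤ) {x}, x ∈ Fᶜ → intVector k + x ∈ Fᶜ := by
    intro k x hx hkx
    obtain ⟨l, y, hy, hyx⟩ := mem_iUnion.1 hkx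
    refine hx (mem_iUnion.2 ⟨l - k, y, hy, ?_⟩)
    have hyx : intVector l + y = intVector k + x := hyx
    ext i
    have := congr_fun hyx i
    simp only [intVector, Pi.add_apply, vadd_eq_add, Pi.sub_apply, Int.cast_sub] at this ⊢
    linarith
  by_cases hcase : ((torusProj n) ⁻¹' C ⊆ F)
  · left
    intro γ hγ
    obtain ⟨e₁, Γ, hΓ⟩ := cov.exists_lift_path γ
    have hrange : range Γ ⊆ F := by
      rintro _ ⟨t, rfl⟩
      refine hcase ?_
      rw [mem_preimage, hΓ]
      exact hγ ⟨t, rfl⟩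
    obtain ⟨k, hk⟩ := mem_iUnion.1 (hcase hx₀)
    have hsub := (isPreconnected_range Γ.continuous).subset_of_subset_iUnion_of_locallyFinite
      hlf hcl hBdisj hrange ⟨e₀, ⟨0, Γ.source⟩, hk⟩
    have he₁ : e₁ ∈ intVector k +ᵥ B := hsub ⟨1, Γ.target⟩
    have hpe : torusProj n e₁ = torusProj n e₀ := by
      rw [← Γ.target, hΓ, γ.target]
    obtain ⟨m, hm⟩ := torusProj_eq_iff.1 hpe
    have hm0 : m = 0 := by
      by_contra hm0
      refine Set.disjoint_left.1 (hBdisj (i := m + k) (j := k) (by simpa using hm0)) ?_ he₁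
      obtain ⟨b, hb, hbe⟩ := hk
      refine ⟨b, hb, ?_⟩
      have hbe : intVector k + b = e₀ := hbe
      rw [hm, ← hbe]
      ext i
      simp [intVector, add_assoc]
    have he : e₁ = e₀ := by
      rw [hm, hm0]
      ext i
      simp [intVector]
    subst he
    exact Path.homotopic_of_lifts cov.continuous Γ (Path.refl _) hΓ fun _ => rfl
  · right
    intro δ
    obtain ⟨e, heC, heF⟩ := not_subset.1 hcase
    have hCpath : IsPathConnected C := by
      have := pathConnectedSpace_sphere hn
      refine isPathConnected_of_interior_of_frontier cov.continuous hsurj hCclosed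
        (isOpen_interior.isConnected_iff_isPathConnected.1 hCint) ?_
      rw [hbd]
      exact isPathConnected_range hs_cont
    have hdich : ∀ x, torusProj n x ∈ C → x ∈ Fᶜ → torusProj n x ∈ interior C := by
      intro x hxC hxF
      by_contra hx
      exact hxF (hBcov ⟨subset_closure hxC, hx⟩)
    have hFC : Fᶜ ⊆ torusProj n ⁻¹' C := by
      refine (IsPreconnected.subset_left_of_subset_union (isOpen_interior.preimage cov.continuous)
        (hCclosed.isOpen_compl.preimage cov.continuous) ?_ ?_ ⟨e, heF, hdich e heC heF⟩
        hFc).trans (preimage_mono interior_subset)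
      · exact Disjoint.preimage _ (disjoint_compl_right.mono_left interior_subset)
      · intro x hx
        by_cases hxC : torusProj n x ∈ C
        · exact Or.inl (hdich x hxC hx)
        · exact Or.inr hxC
    obtain ⟨e₁, Δ, hΔ⟩ := cov.exists_lift_path δ
    have hpe : torusProj n e₁ = torusProj n e₀ := by
      rw [← Δ.target, hΔ, δ.target]
    obtain ⟨m, rfl⟩ := torusProj_eq_iff.1 hpe
    obtain ⟨w, hwe, hw⟩ := cov.exists_joinedIn_preimage (hCpath.joinedIn _ hx₀ _ heC)
    have hwF : w ∈ Fᶜ := by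
      obtain ⟨k, rfl⟩ := torusProj_eq_iff.1 hwe
      exact hFinv k heF
    have hFpath : IsPathConnected Fᶜ :=
      hFo.isConnected_iff_isPathConnected.1 ⟨⟨w, hwF⟩, hFc⟩
    have h₁ : JoinedIn (torusProj n ⁻¹' C) w (intVector m + w) :=
      (hFpath.joinedIn _ hwF _ (hFinv m hwF)).mono hFC
    have h₂ : JoinedIn (torusProj n ⁻¹' C) (intVector m + e₀) (intVector m + w) := by
      refine (hw.map (continuous_const_add (intVector m))).mono ?_
      rintro _ ⟨x, hx, rfl⟩
      rw [mem_preimage, torusProj_eq_iff.2 ⟨m, rfl⟩]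
      exact hx
    obtain ⟨Γ, hΓ⟩ := (hw.trans h₁).trans h₂.symm
    refine ⟨(Γ.map cov.continuous).cast rfl hpe.symm, ?_,
      Path.homotopic_of_lifts cov.continuous Γ Δ (fun _ => rfl) hΔ⟩
    rintro _ ⟨t, rfl⟩
    exact hΓ t
end

section
/- Let n ≥ 2, let T = ℝ^n/ℤ^n with quotient map p : ℝ^n → T, and let C ⊆ T be a compact connected set equal to the closure of its interior, whose interior is connected, and whose topological boundary ∂C is a finite disjoint union of images of injective continuous maps from the (n−1)-sphere S^{n−1} into T. Assume that every loop contained in ∂C is null-homotopic in T. Then the image of the map π_1(C) → π_1(T) ≅ ℤ^n induced by the inclusion i : C → T is either the trivial subgroup or all of ℤ^n. -/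
open Pointwise

section Unicoherence

variable {X : Type*} [TopologicalSpace X]

/-- Unicoherence of a simply connected space, in separation form: if the disjoint closed sets
`A` and `B` both fail to separate `a` from `b`, then so does `A ∪ B`. -/
theorem false_of_separated_by_union_of_closed [SimplyConnectedSpace X]
    [LocallyPathConnectedSpace X] [NormalSpace X] {A B P Q K L : Set X}
    (hA : IsClosed A) (hB : IsClosed B) (hAB : Disjoint A B) (hP : IsOpen P) (hQ : IsOpen Q)
    (hPQ : Disjoint P Q) (hcov : P ∪ Q = (A ∪ B)ᶜ) {a b : X} (ha : a ∈ P) (hb : b ∈ Q)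
    (hK : IsPreconnected K) (hKA : Disjoint K A) (haK : a ∈ K) (hbK : b ∈ K)
    (hL : IsPreconnected L) (hLB : Disjoint L B) (haL : a ∈ L) (hbL : b ∈ L) : False := by
  classical
  obtain ⟨u, hu0, hu1, -⟩ := exists_continuous_zero_one_of_isClosed hA hB hAB
  have hmem (x : X) : (x ∈ P ∧ x ∉ Q ∧ x ∉ A ∧ x ∉ B) ∨ (x ∉ P ∧ x ∈ Q ∧ x ∉ A ∧ x ∉ B) ∨
      (x ∉ P ∧ x ∉ Q ∧ x ∈ A ∧ x ∉ B) ∨ (x ∉ P ∧ x ∉ Q ∧ x ∉ A ∧ x ∈ B) := by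
    have h1 := Set.ext_iff.1 hcov x
    have h2 : x ∈ P → x ∉ Q := fun h h' ↦ Set.disjoint_left.1 hPQ h h'
    have h3 : x ∈ A → x ∉ B := fun h h' ↦ Set.disjoint_left.1 hAB h h'
    simp only [Set.mem_union, Set.mem_compl_iff] at h1
    tauto
  have hfr : ∀ x ∈ frontier P, x ∈ A ∨ x ∈ B := by
    intro x hx
    have h1 : x ∉ P := (hP.frontier_eq ▸ hx).2
    have h2 : x ∉ Q := fun h ↦
      Set.disjoint_left.1 (hPQ.closure_left hQ) (frontier_subset_closure hx) h
    have := hmem x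
    tauto
  have glue (c : ℝ) (D : Set X) (hD : ∀ x ∈ D, x ∈ frontier P → u x = c) :
      ContinuousOn (fun x ↦ if x ∈ P then c else u x) D := by
    apply ContinuousOn.if
    · intro x hx
      exact (hD x hx.1 hx.2).symm
    · exact continuousOn_const
    · exact u.continuous.continuousOn
  let f : X → AddCircle (1 : ℝ) := fun x ↦ if x ∈ P then 0 else (u x : AddCircle (1 : ℝ))
  have hf : Continuous f := by
    refine Continuous.if (p := fun x ↦ x ∈ P) ?_ continuous_const ?_
    · intro x hx
      rcases hfr x hx with h | h
      · simp [hu0 h]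
      · simp [hu1 h, AddCircle.coe_period]
    · exact (AddCircle.continuous_mk' 1).comp u.continuous
  obtain ⟨θ, ⟨-, hθ⟩, -⟩ := (AddCircle.isCoveringMap_coe (1 : ℝ)).existsUnique_continuousMap_lifts
    ⟨f, hf⟩ a 0 (by simp [f, ha])
  have const (c : ℤ) (D : Set X) (hD : ∀ x ∈ D, x ∈ frontier P → u x = c)
      (hDc : IsPreconnected D) (haD : a ∈ D) (hbD : b ∈ D) : θ a - c = θ b - u b := by
    have hT : IsDiscrete (Set.range ((↑) : ℤ → ℝ)) :=
      Int.isClosedEmbedding_coe_real.isEmbedding.isDiscrete_range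
    have := hDc.constant_of_mapsTo hT (f := fun x ↦ θ x - if x ∈ P then (c : ℝ) else u x)
      (θ.continuous.continuousOn.sub (glue c D hD)) ?_ haD hbD
    · have hbP : b ∉ P := fun h ↦ Set.disjoint_left.1 hPQ h hb
      simpa [ha, hbP] using this
    · intro x hx
      have h1 : ((θ x : ℝ) : AddCircle (1 : ℝ)) = f x := congrFun hθ x
      have h2 : ((θ x - (if x ∈ P then (c : ℝ) else u x) : ℝ) : AddCircle (1 : ℝ)) = 0 := by
        rw [AddCircle.coe_sub, h1, sub_eq_zero]
        by_cases hx : x ∈ P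
        · have : ((c : ℝ) : AddCircle (1 : ℝ)) = 0 :=
            (AddCircle.coe_eq_zero_iff 1).2 ⟨c, by simp⟩
          simp [f, hx, this]
        · simp [f, hx]
      obtain ⟨k, hk⟩ := (AddCircle.coe_eq_zero_iff 1).1 h2
      exact ⟨k, by simpa using hk⟩
  have e1 := const 1 K (fun x hx hxP ↦ by
    rcases hfr x hxP with h | h
    · exact (Set.disjoint_left.1 hKA hx h).elim
    · simpa using hu1 h) hK haK hbK
  have e2 := const 0 L (fun x hx hxP ↦ by
    rcases hfr x hxP with h | h
    · simpa using hu0 h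
    · exact (Set.disjoint_left.1 hLB hx h).elim) hL haL hbL
  push_cast at e1 e2
  linarith

end Unicoherence

theorem iUnion_eq_union_iUnion_ne {ι α : Type*} (S : ι → Set α) (i : ι) :
    ⋃ j, S j = S i ∪ ⋃ j : {j // j ≠ i}, S j := by
  ext x
  simp only [Set.mem_iUnion, Set.mem_union, Subtype.exists, exists_prop]
  constructor
  · rintro ⟨j, hj⟩
    by_cases h : j = i
    · exact Or.inl (h ▸ hj)
    · exact Or.inr ⟨j, h, hj⟩
  · rintro (h | ⟨j, -, hj⟩)
    exacts [⟨i, h⟩, ⟨j, hj⟩]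

section Hull

open Bornology Metric

variable {E : Type*} [NormedAddCommGroup E]

/-- The union of the unbounded components of the complement of `S`. -/
def unboundedPart (S : Set E) : Set E :=
  {x | ∃ K : Set E, IsPreconnected K ∧ ¬ IsBounded K ∧ x ∈ K ∧ Disjoint K S}

/-- The set `S` together with the bounded components of its complement. -/
def filledHull (S : Set E) : Set E := (unboundedPart S)ᶜ

theorem subset_unboundedPart {S K : Set E} (hK : IsPreconnected K) (hKb : ¬ IsBounded K)
    (hKS : Disjoint K S) : K ⊆ unboundedPart S :=
  fun _ hx ↦ ⟨K, hK, hKb, hx, hKS⟩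

theorem subset_unboundedPart_of_inter {S K : Set E} (hK : IsPreconnected K) (hKS : Disjoint K S)
    (h : (K ∩ unboundedPart S).Nonempty) : K ⊆ unboundedPart S := by
  obtain ⟨x, hxK, L, hL, hLb, hxL, hLS⟩ := h
  exact Set.subset_union_left.trans (subset_unboundedPart (hK.union x hxK hxL hL)
    (fun h ↦ hLb (h.subset Set.subset_union_right)) (hKS.union_left hLS))

theorem disjoint_unboundedPart (S : Set E) : Disjoint (unboundedPart S) S :=
  Set.disjoint_left.2 fun _ ⟨_, _, _, hx, hKS⟩ ↦ Set.disjoint_left.1 hKS hx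

theorem subset_filledHull (S : Set E) : S ⊆ filledHull S :=
  (disjoint_unboundedPart S).subset_compl_left

theorem subset_filledHull_of_not_subset {S K : Set E} (hK : IsPreconnected K)
    (hKS : Disjoint K S) (h : ¬ K ⊆ unboundedPart S) : K ⊆ filledHull S := fun x hx hx' ↦
  h (subset_unboundedPart_of_inter hK hKS ⟨x, hx, hx'⟩)

theorem unboundedPart_vadd (z : E) (S : Set E) : unboundedPart (z +ᵥ S) = z +ᵥ unboundedPart S := by
  have key (z : E) (S : Set E) : z +ᵥ unboundedPart S ⊆ unboundedPart (z +ᵥ S) := by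
    rintro _ ⟨x, ⟨K, hK, hKb, hxK, hKS⟩, rfl⟩
    refine ⟨z +ᵥ K, hK.image _ (by fun_prop), fun hb ↦ hKb ?_, Set.vadd_mem_vadd_set hxK,
      Set.disjoint_vadd_set.2 hKS⟩
    simpa using hb.vadd (-z)
  refine (key z S).antisymm' ?_
  have := key (-z) (z +ᵥ S)
  rw [neg_vadd_vadd] at this
  exact fun x hx ↦ Set.mem_vadd_set_iff_neg_vadd_mem.2 (this (Set.vadd_mem_vadd_set hx))

theorem exists_ball_disjoint_iUnion_ne {ι : Type*} {S : ι → Set E}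
    (hSc : ∀ i, IsCompact (S i)) (hlf : LocallyFinite S)
    (hdisj : ∀ i j, i ≠ j → Disjoint (S i) (S j)) {i : ι} :
    IsClosed (⋃ j : {j // j ≠ i}, S j) ∧ Disjoint (S i) (⋃ j : {j // j ≠ i}, S j) ∧
      ∀ q ∈ S i, ∃ ε > 0, Disjoint (ball q ε) (⋃ j : {j // j ≠ i}, S j) := by
  have hc : IsClosed (⋃ j : {j // j ≠ i}, S j) :=
    (hlf.comp_injective Subtype.val_injective).isClosed_iUnion fun j ↦ (hSc j).isClosed
  have hd : Disjoint (S i) (⋃ j : {j // j ≠ i}, S j) :=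
    Set.disjoint_iUnion_right.2 fun j ↦ hdisj i j j.2.symm
  refine ⟨hc, hd, fun q hq ↦ ?_⟩
  obtain ⟨ε, hε, hb⟩ := isOpen_iff.1 hc.isOpen_compl q (Set.disjoint_left.1 hd hq)
  exact ⟨ε, hε, Set.subset_compl_iff_disjoint_right.1 hb⟩

theorem filledHull_vadd (z : E) (S : Set E) : filledHull (z +ᵥ S) = z +ᵥ filledHull S := by
  rw [filledHull, filledHull, unboundedPart_vadd, Set.vadd_set_compl]

variable [NormedSpace ℝ E]

theorem isOpen_unboundedPart {S : Set E} (hS : IsClosed S) : IsOpen (unboundedPart S) := by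
  rw [isOpen_iff]
  intro x hx
  obtain ⟨ε, hε, hb⟩ := isOpen_iff.1 hS.isOpen_compl x
    (Set.disjoint_left.1 (disjoint_unboundedPart S) hx)
  exact ⟨ε, hε, subset_unboundedPart_of_inter isPreconnected_ball
    (Set.subset_compl_iff_disjoint_right.1 hb) ⟨x, mem_ball_self hε, hx⟩⟩

theorem isClosed_filledHull {S : Set E} (hS : IsClosed S) : IsClosed (filledHull S) :=
  (isOpen_unboundedPart hS).isClosed_compl

theorem isOpen_filledHull_diff {S : Set E} (hS : IsClosed S) : IsOpen (filledHull S \ S) := by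
  rw [isOpen_iff]
  intro x hx
  obtain ⟨ε, hε, hb⟩ := isOpen_iff.1 hS.isOpen_compl x hx.2
  have hbS : Disjoint (ball x ε) S := Set.subset_compl_iff_disjoint_right.1 hb
  exact ⟨ε, hε, Set.subset_sdiff.2 ⟨subset_filledHull_of_not_subset isPreconnected_ball hbS
    fun h ↦ hx.1 (h (mem_ball_self hε)), hbS⟩⟩

theorem isPreconnected_setOf_le_norm (h : 1 < Module.rank ℝ E) {R : ℝ} (hR : 0 < R) :
    IsPreconnected {x : E | R ≤ ‖x‖} := by
  have : {x : E | R ≤ ‖x‖} = (fun q : E × ℝ ↦ q.2 • q.1) '' (sphere 0 1 ×ˢ Set.Ici R) := by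
    ext x
    constructor
    · intro hx
      have h0 : ‖x‖ ≠ 0 := (hR.trans_le hx).ne'
      exact ⟨(‖x‖⁻¹ • x, ‖x‖), ⟨by simp [norm_smul, h0], hx⟩, by simp [smul_smul, h0]⟩
    · rintro ⟨⟨v, r⟩, ⟨hv, hr⟩, rfl⟩
      have h1 : ‖v‖ = 1 := by simpa using hv
      have h2 : R ≤ r := hr
      simp [norm_smul, h1, abs_of_pos (hR.trans_le h2), h2]
  rw [this]
  exact ((isPreconnected_sphere h 0 1).prod isPreconnected_Ici).image _
    (by fun_prop)

theorem not_isBounded_setOf_le_norm [Nontrivial E] (R : ℝ) :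
    ¬ IsBounded {x : E | R ≤ ‖x‖} := by
  intro h
  have h2 : IsBounded (ball (0 : E) R) := isBounded_ball
  apply NormedSpace.unbounded_univ ℝ E
  refine (h.union h2).subset fun x _ ↦ ?_
  rcases le_or_gt R ‖x‖ with h | h
  · exact Or.inl h
  · exact Or.inr (by simpa using h)

theorem exists_setOf_le_norm_subset_unboundedPart (h : 1 < Module.rank ℝ E) {S : Set E}
    (hS : IsBounded S) : ∃ R > 0, {x : E | R ≤ ‖x‖} ⊆ unboundedPart S := by
  have : Nontrivial E := rank_pos_iff_nontrivial.1 (zero_lt_one.trans h)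
  obtain ⟨R, hR, hSR⟩ := hS.exists_pos_norm_lt
  refine ⟨R, hR, subset_unboundedPart (isPreconnected_setOf_le_norm h hR)
    (not_isBounded_setOf_le_norm R) (Set.disjoint_left.2 fun x hx hxS ↦ ?_)⟩
  exact absurd (hSR x hxS) (not_lt.2 hx)

theorem isBounded_filledHull (h : 1 < Module.rank ℝ E) {S : Set E} (hS : IsBounded S) :
    IsBounded (filledHull S) := by
  obtain ⟨R, -, hR⟩ := exists_setOf_le_norm_subset_unboundedPart h hS
  refine (isBounded_ball (x := (0 : E)) (r := R)).subset fun x hx ↦ ?_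
  by_contra hx'
  exact hx (hR (by simpa using hx'))

theorem isPreconnected_unboundedPart (h : 1 < Module.rank ℝ E) {S : Set E} (hS : IsBounded S) :
    IsPreconnected (unboundedPart S) := by
  have : Nontrivial E := rank_pos_iff_nontrivial.1 (zero_lt_one.trans h)
  obtain ⟨R, hR0, hR⟩ := exists_setOf_le_norm_subset_unboundedPart h hS
  have hRc := isPreconnected_setOf_le_norm h hR0
  have meets {K : Set E} (hK : ¬ IsBounded K) : ∃ x ∈ K, x ∈ {x : E | R ≤ ‖x‖} := by
    by_contra! hc
    exact hK ((isBounded_ball (x := (0 : E)) (r := R)).subset fun x hx ↦ by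
      simpa using hc x hx)
  obtain ⟨v, hv⟩ : {x : E | R ≤ ‖x‖}.Nonempty := by
    by_contra! hc
    exact not_isBounded_setOf_le_norm (E := E) R (hc ▸ isBounded_empty)
  refine isPreconnected_of_forall v ?_
  rintro x ⟨K, hK, hKb, hxK, hKS⟩
  obtain ⟨y, hyK, hy⟩ := meets hKb
  exact ⟨K ∪ {x : E | R ≤ ‖x‖}, Set.union_subset (subset_unboundedPart hK hKb hKS) hR,
    Or.inr hv, Or.inl hxK, hK.union y hyK hy hRc⟩

theorem not_isBounded_unboundedPart (h : 1 < Module.rank ℝ E) {S : Set E} (hS : IsBounded S) :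
    ¬ IsBounded (unboundedPart S) := by
  have : Nontrivial E := rank_pos_iff_nontrivial.1 (zero_lt_one.trans h)
  obtain ⟨R, -, hR⟩ := exists_setOf_le_norm_subset_unboundedPart h hS
  exact fun hb ↦ not_isBounded_setOf_le_norm (E := E) R (hb.subset hR)

theorem filledHull_subset_of_subset (h : 1 < Module.rank ℝ E) {S S' : Set E} (hS : IsBounded S)
    (hSS' : S' ⊆ filledHull S) : filledHull S' ⊆ filledHull S :=
  Set.compl_subset_compl.2 <| subset_unboundedPart (isPreconnected_unboundedPart h hS)
    (not_isBounded_unboundedPart h hS) (Set.disjoint_left.2 fun _ hx hx' ↦ hSS' hx' hx)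

/-- A segment from a point outside the closed set `S` to a point of `S`, cut off when it
first meets `S`. -/
theorem exists_segment_first_hit {S : Set E} (hS : IsClosed S) {x y : E} (hx : x ∉ S)
    (hy : y ∈ S) : ∃ q ∈ S, q ∈ segment ℝ x y ∧ ∃ K : Set E, IsPreconnected K ∧ x ∈ K ∧
      Disjoint K S ∧ q ∈ closure K ∧ K ⊆ segment ℝ x y ∧ JoinedIn (insert q K) x q := by
  let g : ℝ → E := AffineMap.lineMap x y
  have hg : Continuous g := AffineMap.lineMap_continuous
  have hg0 : g 0 = x := AffineMap.lineMap_apply_zero _ _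
  have hg1 : g 1 = y := AffineMap.lineMap_apply_one _ _
  have hc : IsCompact (Set.Icc (0 : ℝ) 1 ∩ g ⁻¹' S) := isCompact_Icc.inter_right (hS.preimage hg)
  obtain ⟨t, ⟨⟨ht0, ht1⟩, htS⟩, hmin⟩ := hc.exists_isLeast ⟨1, ⟨zero_le_one, le_rfl⟩, by
    rwa [Set.mem_preimage, hg1]⟩
  have htpos : 0 < t := ht0.lt_of_ne fun h ↦ hx (by rw [← hg0, h]; exact htS)
  have hseg : g '' Set.Icc 0 1 = segment ℝ x y := (segment_eq_image_lineMap ℝ x y).symm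
  refine ⟨g t, htS, hseg ▸ ⟨t, ⟨ht0, ht1⟩, rfl⟩, g '' Set.Ico 0 t,
    isPreconnected_Ico.image _ hg.continuousOn, ⟨0, ⟨le_rfl, htpos⟩, hg0⟩, ?_, ?_, ?_, ?_⟩
  · rw [Set.disjoint_left]
    rintro _ ⟨r, ⟨hr0, hrt⟩, rfl⟩ hr
    exact absurd (hmin ⟨⟨hr0, hrt.le.trans ht1⟩, hr⟩) (not_le.2 hrt)
  · apply image_closure_subset_closure_image hg
    rw [closure_Ico htpos.ne]
    exact ⟨t, ⟨ht0, le_rfl⟩, rfl⟩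
  · rw [← hseg]
    exact Set.image_mono fun r hr ↦ ⟨hr.1, hr.2.le.trans ht1⟩
  · have hIcc : insert (g t) (g '' Set.Ico 0 t) = g '' Set.Icc 0 t := by
      rw [← Set.image_insert_eq, Set.Ico_insert_right ht0]
    rw [hIcc, ← hg0]
    exact (((convex_Icc (0 : ℝ) t).isPathConnected ⟨0, le_rfl, ht0⟩).image hg).joinedIn _
      ⟨0, ⟨le_rfl, ht0⟩, rfl⟩ _ ⟨t, ⟨ht0, le_rfl⟩, rfl⟩

theorem disjoint_filledHull {S S' : Set E} (hS : IsClosed S) (hS' : IsClosed S')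
    (hne : S.Nonempty) (h : S ⊆ unboundedPart S')
    (h' : S' ⊆ unboundedPart S) : Disjoint (filledHull S) (filledHull S') := by
  rw [Set.disjoint_left]
  intro x hx hx'
  obtain ⟨s, hs⟩ := hne
  have hxS : x ∉ S := fun hxS ↦ hx' (h hxS)
  obtain ⟨q, hqS, -, K, hK, hxK, hKS, hqK, -, -⟩ := exists_segment_first_hit hS hxS hs
  have hKS' : Disjoint K S' := by
    rw [Set.disjoint_left]
    intro y hyK hyS'
    exact hx (subset_unboundedPart_of_inter hK hKS ⟨y, hyK, h' hyS'⟩ hxK)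
  obtain ⟨y, hyU, hyK⟩ := mem_closure_iff.1 hqK _ (isOpen_unboundedPart hS') (h hqS)
  exact hx' (subset_unboundedPart_of_inter hK hKS' ⟨y, hyK, hyU⟩ hxK)

theorem not_vadd_subset_filledHull (h : 1 < Module.rank ℝ E) {S : Set E} (hS : IsBounded S)
    (hne : S.Nonempty) {z : E} (hz : z ≠ 0) : ¬ z +ᵥ S ⊆ filledHull S := by
  intro hsub
  have hstep := filledHull_subset_of_subset h hS hsub
  rw [filledHull_vadd] at hstep
  obtain ⟨s, hs⟩ := hne
  have hiter (k : ℕ) : k • z + s ∈ filledHull S := by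
    induction k with
    | zero => simpa using subset_filledHull S hs
    | succ k ih =>
      have := hstep (Set.vadd_mem_vadd_set ih)
      rwa [vadd_eq_add, ← add_assoc, ← succ_nsmul'] at this
  obtain ⟨R, hR⟩ := (isBounded_filledHull h hS).exists_norm_le
  obtain ⟨k, hk⟩ := exists_nat_gt ((R + ‖s‖) / ‖z‖)
  rw [div_lt_iff₀ (norm_pos_iff.2 hz)] at hk
  have h1 : ‖k • z‖ = k * ‖z‖ := by rw [← Nat.cast_smul_eq_nsmul ℝ, norm_smul]; simp
  have h2 := norm_sub_norm_le (k • z) (-s)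
  rw [sub_neg_eq_add, norm_neg] at h2
  linarith [hR _ (hiter k)]

theorem disjoint_vadd_filledHull (h : 1 < Module.rank ℝ E) {S : Set E} (hS : IsCompact S)
    (hSc : IsPreconnected S) (hne : S.Nonempty) {z : E} (hz : z ≠ 0)
    (hdisj : Disjoint (z +ᵥ S) S) : Disjoint (filledHull S) (z +ᵥ filledHull S) := by
  rw [← filledHull_vadd]
  refine disjoint_filledHull hS.isClosed (hS.vadd z).isClosed hne ?_ ?_
  · by_contra hc
    have h1 := subset_filledHull_of_not_subset hSc hdisj.symm hc
    rw [filledHull_vadd] at h1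
    refine not_vadd_subset_filledHull h hS.isBounded hne (neg_ne_zero.2 hz) ?_
    rintro _ ⟨s, hs, rfl⟩
    exact Set.mem_vadd_set_iff_neg_vadd_mem.1 (h1 hs)
  · by_contra hc
    exact not_vadd_subset_filledHull h hS.isBounded hne hz
      (subset_filledHull_of_not_subset (hSc.image _ (by fun_prop)) hdisj hc)

theorem IsPreconnected.subset_interior_of_disjoint_frontier {X : Type*} [TopologicalSpace X]
    {K D : Set X} (hK : IsPreconnected K) (hD : Disjoint K (frontier D)) (h : (K ∩ D).Nonempty) :
    K ⊆ interior D := by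
  by_contra hc
  obtain ⟨x, hxK, hx⟩ := Set.not_subset.1 hc
  have hcov : K ⊆ interior D ∪ (closure D)ᶜ := fun y hy ↦ by
    by_cases h1 : y ∈ closure D
    · exact Or.inl (by_contra fun h2 ↦ Set.disjoint_left.1 hD hy ⟨h1, h2⟩)
    · exact Or.inr h1
  obtain ⟨y, hyK, hyD⟩ := h
  obtain ⟨w, -, hw, hw'⟩ := hK _ _ isOpen_interior isClosed_closure.isOpen_compl hcov
    ⟨y, hyK, (hcov hyK).resolve_right fun h ↦ h (subset_closure hyD)⟩
    ⟨x, hxK, (hcov hxK).resolve_left hx⟩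
  exact hw' (subset_closure (interior_subset hw))

section Core

variable {ι : Type*} {X : Set E} {S : ι → Set E}

theorem subset_unboundedPart_of_disjoint_interior (hX : IsClosed X) (hXi : X ⊆ closure (interior X))
    (hfr : frontier X = ⋃ i, S i) (hSc : ∀ i, IsCompact (S i))
    (hSp : ∀ i, IsPathConnected (S i)) (hdisj : ∀ i j, i ≠ j → Disjoint (S i) (S j))
    (hint : ∀ i, Disjoint (interior X) (filledHull (S i))) {i j : ι} (hij : i ≠ j) :
    S j ⊆ unboundedPart (S i) := by
  by_contra hc
  have hji := hdisj j i hij.symm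
  have h1 := subset_filledHull_of_not_subset (hSp j).isConnected.isPreconnected hji hc
  obtain ⟨q, hq⟩ := (hSp j).nonempty
  have hqX : q ∈ X := hX.frontier_subset (hfr ▸ Set.mem_iUnion.2 ⟨j, hq⟩)
  obtain ⟨y, hy, hy'⟩ := mem_closure_iff.1 (hXi hqX) _ (isOpen_filledHull_diff (hSc i).isClosed)
    ⟨h1 hq, Set.disjoint_left.1 hji hq⟩
  exact Set.disjoint_left.1 (hint i) hy' hy.1

theorem exists_ball_joinedIn (hX : IsClosed X)
    (hfr : frontier X = ⋃ i, S i) (hSc : ∀ i, IsCompact (S i))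
    (hSp : ∀ i, IsPathConnected (S i)) (hdisj : ∀ i j, i ≠ j → Disjoint (S i) (S j))
    (hlf : LocallyFinite S) {z : E} (hz : z ∈ X) :
    ∃ ε > 0, ∀ w ∈ X, w ∈ ball z ε → JoinedIn X w z := by
  by_cases hzi : z ∈ interior X
  · obtain ⟨ε, hε, hb⟩ := isOpen_iff.1 isOpen_interior z hzi
    exact ⟨ε, hε, fun w _ hw ↦ ((isPathConnected_ball hε).joinedIn w hw z (mem_ball_self hε)).mono
      (hb.trans interior_subset)⟩
  have hSX (j) : S j ⊆ X := (hfr ▸ Set.subset_iUnion S j).trans hX.frontier_subset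
  obtain ⟨i, hi⟩ : ∃ i, z ∈ S i := Set.mem_iUnion.1 (hfr ▸ ⟨subset_closure hz, hzi⟩)
  obtain ⟨-, -, hball⟩ := exists_ball_disjoint_iUnion_ne hSc hlf hdisj (i := i)
  obtain ⟨ε, hε, hb⟩ := hball z hi
  refine ⟨ε, hε, fun w hwX hw ↦ ?_⟩
  by_cases hwi : w ∈ S i
  · exact ((hSp i).joinedIn w hwi z hi).mono (hSX i)
  obtain ⟨q, hq, -, K, hK, hwK, hKS, -, hKseg, hj⟩ :=
    exists_segment_first_hit (hSc i).isClosed hwi hi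
  have hKb : K ⊆ ball z ε :=
    hKseg.trans ((convex_ball z ε).segment_subset hw (mem_ball_self hε))
  have hKfr : Disjoint K (frontier X) := by
    rw [hfr, iUnion_eq_union_iUnion_ne S i]
    exact hKS.union_right (hb.mono_left hKb)
  have hKX := (hK.subset_interior_of_disjoint_frontier hKfr ⟨w, hwK, hwX⟩).trans interior_subset
  exact (hj.mono (Set.insert_subset (hSX i hq) hKX)).trans
    (((hSp i).joinedIn q hq z hi).mono (hSX i))

theorem exists_mem_filledHull_of_notMem (h : 1 < Module.rank ℝ E) (hX : IsClosed X)
    (hXi : X ⊆ closure (interior X)) (hne : X.Nonempty)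
    (hfr : frontier X = ⋃ i, S i) (hSc : ∀ i, IsCompact (S i))
    (hdisj : ∀ i j, i ≠ j → Disjoint (S i) (S j))
    (hlf : LocallyFinite S) (hint : ∀ i, Disjoint (interior X) (filledHull (S i)))
    {z : E} (hz : z ∉ X) : ∃ i, z ∈ filledHull (S i) := by
  obtain ⟨x, hx⟩ := hne
  obtain ⟨q, hqX, -, K, hK, hzK, hKX, hqK, -, -⟩ := exists_segment_first_hit hX hz hx
  have hqi : q ∉ interior X := fun hq ↦ by
    obtain ⟨y, hy, hyK⟩ := mem_closure_iff.1 hqK _ isOpen_interior hq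
    exact Set.disjoint_left.1 hKX hyK (interior_subset hy)
  obtain ⟨i, hi⟩ : ∃ i, q ∈ S i := Set.mem_iUnion.1 (hfr ▸ ⟨subset_closure hqX, hqi⟩)
  have hSX : S i ⊆ X := (hfr ▸ Set.subset_iUnion S i).trans hX.frontier_subset
  refine ⟨i, fun hzU ↦ ?_⟩
  have hKU := subset_unboundedPart_of_inter hK (hKX.mono_right hSX) ⟨z, hzK, hzU⟩
  obtain ⟨hBc, hBd, hball⟩ := exists_ball_disjoint_iUnion_ne hSc hlf hdisj (i := i)
  obtain ⟨ε, hε, hb⟩ := hball q hi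
  obtain ⟨a, hab, haK⟩ := mem_closure_iff.1 hqK _ isOpen_ball (mem_ball_self hε)
  obtain ⟨b, hbb, hbX⟩ := mem_closure_iff.1 (hXi hqX) _ isOpen_ball (mem_ball_self hε)
  have hbU : b ∈ unboundedPart (S i) := by
    by_contra hc
    exact Set.disjoint_left.1 (hint i) hbX hc
  refine false_of_separated_by_union_of_closed (hSc i).isClosed hBc hBd hX.isOpen_compl
    (isOpen_interior (s := X)) (disjoint_compl_left.mono_right interior_subset) ?_
    (Set.disjoint_left.1 hKX haK) hbX (isPreconnected_unboundedPart h (hSc i).isBounded)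
    (disjoint_unboundedPart _) (hKU haK) hbU isPreconnected_ball hb hab hbb
  rw [← iUnion_eq_union_iUnion_ne, ← hfr, hX.frontier_eq, Set.sdiff_eq, Set.compl_inter, compl_compl]

/-- A closed domain bounded by a locally finite family of disjoint compact path connected sets,
all of which are seen from the unbounded side, is path connected. -/
theorem joinedIn_of_disjoint_filledHull (h : 1 < Module.rank ℝ E) (hX : IsClosed X)
    (hXi : X ⊆ closure (interior X))
    (hfr : frontier X = ⋃ i, S i) (hSc : ∀ i, IsCompact (S i))
    (hSp : ∀ i, IsPathConnected (S i)) (hdisj : ∀ i j, i ≠ j → Disjoint (S i) (S j))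
    (hlf : LocallyFinite fun i ↦ filledHull (S i))
    (hint : ∀ i, Disjoint (interior X) (filledHull (S i))) {x y : E} (hx : x ∈ X) (hy : y ∈ X) :
    JoinedIn X x y := by
  have hlfS : LocallyFinite S := hlf.subset fun i ↦ subset_filledHull (S i)
  have hunb {i j : ι} (hij : i ≠ j) : S j ⊆ unboundedPart (S i) :=
    subset_unboundedPart_of_disjoint_interior hX hXi hfr hSc hSp hdisj hint hij
  have hhull {i j : ι} (hij : i ≠ j) : Disjoint (filledHull (S i)) (filledHull (S j)) :=
    disjoint_filledHull (hSc i).isClosed (hSc j).isClosed (hSp i).nonempty (hunb hij.symm)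
      (hunb hij)
  have hSX (j) : S j ⊆ X := (hfr ▸ Set.subset_iUnion S j).trans hX.frontier_subset
  have hXhull {i : ι} {w : E} (hw : w ∈ X) (hwi : w ∈ filledHull (S i)) : w ∈ S i := by
    obtain ⟨j, hj⟩ : ∃ j, w ∈ S j := Set.mem_iUnion.1
      (hfr ▸ ⟨subset_closure hw, fun hw ↦ Set.disjoint_left.1 (hint i) hw hwi⟩)
    by_cases hij : i = j
    · exact hij ▸ hj
    · exact (hwi (hunb hij hj)).elim
  by_contra hxy
  let A₀ : Set E := {w | w ∈ X ∧ JoinedIn X w x}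
  let B₀ : Set E := {w | w ∈ X ∧ ¬ JoinedIn X w x}
  have hclosed (p : Prop → Prop) : IsClosed {w | w ∈ X ∧ p (JoinedIn X w x)} := by
    rw [← closure_subset_iff_isClosed]
    intro w hw
    have hwX : w ∈ X := hX.closure_subset_iff.2 (fun _ hv ↦ hv.1) hw
    obtain ⟨ε, hε, hb⟩ := exists_ball_joinedIn hX hfr hSc hSp hdisj hlfS hwX
    obtain ⟨v, hvb, hvX, hv⟩ := mem_closure_iff.1 hw _ isOpen_ball (mem_ball_self hε)
    have hvw := hb v hvX hvb
    have heq : JoinedIn X v x = JoinedIn X w x :=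
      propext ⟨fun h ↦ hvw.symm.trans h, fun h ↦ hvw.trans h⟩
    exact ⟨hwX, heq ▸ hv⟩
  have hA₀ : IsClosed A₀ := hclosed id
  have hB₀ : IsClosed B₀ := hclosed Not
  have hhc (q : ι → Prop) : IsClosed (⋃ i : {i // q i}, filledHull (S i)) :=
    (hlf.comp_injective (Subtype.val_injective (p := q))).isClosed_iUnion
      fun i ↦ isClosed_filledHull (hSc i).isClosed
  have hcov : (Set.univ : Set E) ⊆
      (A₀ ∪ ⋃ i : {i // (S i ∩ A₀).Nonempty}, filledHull (S i)) ∪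
      (B₀ ∪ ⋃ i : {i // ¬ (S i ∩ A₀).Nonempty}, filledHull (S i)) := by
    intro w _
    by_cases hw : w ∈ X
    · by_cases hwx : JoinedIn X w x
      · exact Or.inl (Or.inl ⟨hw, hwx⟩)
      · exact Or.inr (Or.inl ⟨hw, hwx⟩)
    obtain ⟨i, hi⟩ :=
      exists_mem_filledHull_of_notMem h hX hXi ⟨x, hx⟩ hfr hSc hdisj hlfS hint hw
    by_cases hq : (S i ∩ A₀).Nonempty
    · exact Or.inl (Or.inr (Set.mem_iUnion.2 ⟨⟨i, hq⟩, hi⟩))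
    · exact Or.inr (Or.inr (Set.mem_iUnion.2 ⟨⟨i, hq⟩, hi⟩))
  obtain ⟨w, -, hwA, hwB⟩ := isPreconnected_closed_iff.1 isPreconnected_univ _ _
    (hA₀.union (hhc _)) (hB₀.union (hhc _)) hcov
    ⟨x, trivial, Or.inl ⟨hx, JoinedIn.refl hx⟩⟩ ⟨y, trivial, Or.inl ⟨hy, fun h ↦ hxy h.symm⟩⟩
  rcases hwA with hwA | hwA <;> rcases hwB with hwB | hwB
  · exact hwB.2 hwA.2
  · obtain ⟨⟨i, hq⟩, hi⟩ := Set.mem_iUnion.1 hwB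
    exact hq ⟨w, hXhull hwA.1 hi, hwA⟩
  · obtain ⟨⟨i, s, hs, hsA⟩, hi⟩ := Set.mem_iUnion.1 hwA
    exact hwB.2 ((((hSp i).joinedIn w (hXhull hwB.1 hi) s hs).mono (hSX i)).trans hsA.2)
  · obtain ⟨⟨i, hqi⟩, hi⟩ := Set.mem_iUnion.1 hwA
    obtain ⟨⟨j, hqj⟩, hj⟩ := Set.mem_iUnion.1 hwB
    refine Set.disjoint_left.1 (hhull ?_) hi hj
    rintro rfl
    exact hqj hqi

end Core

end Hull

section Torus

open Bornology Metric

/-- The quotient homomorphism from `ℝⁿ` onto the torus. -/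
def torusMk (n : ℕ) : (Fin n → ℝ) →+ (Fin n → AddCircle (1 : ℝ)) where
  toFun x i := (x i : AddCircle (1 : ℝ))
  map_zero' := rfl
  map_add' _ _ := rfl

/-- The inclusion of the integer lattice in `ℝⁿ`. -/
def latticeVec {n : ℕ} (v : Fin n → ℤ) : Fin n → ℝ := fun i ↦ v i

theorem latticeVec_injective {n : ℕ} : Function.Injective (latticeVec (n := n)) :=
  fun _ _ h ↦ funext fun i ↦ Int.cast_injective (congrFun h i)

@[simp]
theorem torusMk_latticeVec {n : ℕ} (v : Fin n → ℤ) : torusMk n (latticeVec v) = 0 :=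
  funext fun i ↦ (AddCircle.coe_eq_zero_iff 1).2 ⟨v i, by simp [latticeVec]⟩

theorem exists_latticeVec_of_torusMk_eq {n : ℕ} {x y : Fin n → ℝ}
    (h : torusMk n x = torusMk n y) : ∃ v, y = latticeVec v + x := by
  have (i : Fin n) : ∃ k : ℤ, y i = k + x i := by
    have h1 : ((y i - x i : ℝ) : AddCircle (1 : ℝ)) = 0 := by
      rw [AddCircle.coe_sub, sub_eq_zero]
      exact (congrFun h i).symm
    obtain ⟨k, hk⟩ := (AddCircle.coe_eq_zero_iff 1).1 h1
    exact ⟨k, by simp at hk; linarith⟩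
  choose v hv using this
  exact ⟨v, funext hv⟩

theorem isOpenQuotientMap_torusMk (n : ℕ) : IsOpenQuotientMap (torusMk n) :=
  IsOpenQuotientMap.piMap fun _ ↦ QuotientAddGroup.isOpenQuotientMap_mk

theorem isCoveringMap_torusMk (n : ℕ) : IsCoveringMap (torusMk n) := by
  refine (isOpenQuotientMap_torusMk n).isQuotientMap
    |>.isAddQuotientCoveringMap_of_isDiscrete_ker_addMonoidHom ?_ |>.isCoveringMap
  have hr : ((torusMk n).ker : Set (Fin n → ℝ)) = Set.range latticeVec := by
    ext x
    constructor
    · intro hx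
      obtain ⟨v, hv⟩ := exists_latticeVec_of_torusMk_eq (x := 0) (y := x)
        (by rw [map_zero]; exact hx.symm)
      exact ⟨v, by simp [hv]⟩
    · rintro ⟨v, rfl⟩
      exact torusMk_latticeVec v
  rw [hr]
  exact (Topology.IsEmbedding.piMap
    fun _ : Fin n ↦ Int.isClosedEmbedding_coe_real.isEmbedding).isDiscrete_range

theorem finite_setOf_norm_latticeVec_le (n : ℕ) (R : ℝ) :
    {v : Fin n → ℤ | ‖latticeVec v‖ ≤ R}.Finite := by
  refine (Set.finite_Icc (fun _ ↦ -⌈R⌉) (fun _ ↦ ⌈R⌉)).subset fun v hv ↦ ?_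
  have key (i : Fin n) : |v i| ≤ ⌈R⌉ := by
    have h1 := (norm_le_pi_norm (latticeVec v) i).trans hv
    have h2 : ((|v i| : ℤ) : ℝ) ≤ ⌈R⌉ := by
      rw [Int.cast_abs]
      exact h1.trans (Int.le_ceil R)
    exact_mod_cast h2
  exact ⟨fun i ↦ (abs_le.1 (key i)).1, fun i ↦ (abs_le.1 (key i)).2⟩

theorem locallyFinite_latticeVec_vadd {n : ℕ} {κ : Type*} [Finite κ] {D : κ → Set (Fin n → ℝ)}
    (hD : ∀ k, IsBounded (D k)) :
    LocallyFinite fun i : κ × (Fin n → ℤ) ↦ latticeVec i.2 +ᵥ D i.1 := by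
  intro x
  obtain ⟨M, hM⟩ := (isBounded_iUnion.2 hD).exists_norm_le
  refine ⟨ball x 1, ball_mem_nhds x one_pos,
    (Set.finite_univ.prod (finite_setOf_norm_latticeVec_le n (‖x‖ + 1 + M))).subset ?_⟩
  rintro ⟨k, v⟩ ⟨y, ⟨d, hd, rfl⟩, hy⟩
  refine ⟨trivial, ?_⟩
  have h1 := hM d (Set.mem_iUnion.2 ⟨k, hd⟩)
  have h2 : ‖latticeVec v + d - x‖ < 1 := by simpa [dist_eq_norm] using hy
  have h3 : latticeVec v = (latticeVec v + d - x) + x - d := by abel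
  calc ‖latticeVec v‖ = ‖(latticeVec v + d - x) + x - d‖ := by rw [← h3]
    _ ≤ ‖latticeVec v + d - x‖ + ‖x‖ + ‖d‖ :=
      (norm_sub_le _ _).trans (add_le_add_left (norm_add_le _ _) _)
    _ ≤ ‖x‖ + 1 + M := by linarith

/-- A map from a path connected, locally path connected space all of whose loops become
null-homotopic lifts through a covering map. -/
theorem IsCoveringMap.exists_lift_of_loops_nullhomotopic {A B Y : Type*} [TopologicalSpace A]
    [TopologicalSpace B] [TopologicalSpace Y] {p : B → Y} (cov : IsCoveringMap p)
    (hp : Function.Surjective p) [PathConnectedSpace A] [LocallyPathConnectedSpace A] (f : C(A, Y))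
    (h : ∀ (a : A) (γ : Path a a), (γ.map f.continuous).Homotopic (Path.refl (f a))) :
    ∃ F : C(A, B), p ∘ F = f := by
  obtain ⟨a⟩ : Nonempty A := inferInstance
  obtain ⟨b, hb⟩ := hp (f a)
  obtain ⟨F, ⟨-, hF⟩, -⟩ := cov.existsUnique_continuousMap_lifts_of_range_le hb (by
    rintro _ ⟨g, rfl⟩
    suffices FundamentalGroup.map f a g = 1 from this ▸ one_mem _
    obtain ⟨γ, rfl⟩ := Path.Homotopic.Quotient.mk_surjective g
    exact Path.Homotopic.Quotient.eq.2 (h a γ))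
  exact ⟨F, hF⟩

theorem IsCoveringMap.homotopic_of_lifts_joined {B Y : Type*} [TopologicalSpace B]
    [TopologicalSpace Y] [SimplyConnectedSpace B] {p : B → Y} (cov : IsCoveringMap p)
    {x₀ : Y} {b : B} (hb : p b = x₀) (γ : Path x₀ x₀) :
    ∃ (b' : B) (hb' : p b' = x₀) (Γ : Path b b'), (∀ t, p (Γ t) = γ t) ∧
      ∀ Γ' : Path b b', ((Γ'.map cov.continuous).cast hb.symm hb'.symm).Homotopic γ := by
  have h0 : γ.toContinuousMap 0 = p b := by simp [hb]
  have hl := cov.liftPath_lifts γ.toContinuousMap b h0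
  let Γ : Path b (cov.liftPath γ.toContinuousMap b h0 1) :=
    ⟨cov.liftPath γ.toContinuousMap b h0, cov.liftPath_zero _ _ _, rfl⟩
  have hb' : p (cov.liftPath γ.toContinuousMap b h0 1) = x₀ :=
    (congrFun hl 1).trans γ.target
  refine ⟨_, hb', Γ, congrFun hl, fun Γ' ↦ ?_⟩
  have := ((SimplyConnectedSpace.paths_homotopic Γ' Γ).map ⟨p, cov.continuous⟩).pathCast
    hb.symm hb'.symm
  have heq : (Γ.map cov.continuous).cast hb.symm hb'.symm = γ := by
    ext t
    exact congrFun hl t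
  rw [heq] at this
  exact this

/-- Loops in a set covered by a compact set `D` with disjoint lattice translates are trivial. -/
theorem homotopic_refl_of_subset_image {n : ℕ} {C : Set (Fin n → AddCircle (1 : ℝ))}
    {D : Set (Fin n → ℝ)} (hD : IsCompact D)
    (hdisj : ∀ v : Fin n → ℤ, v ≠ 0 → Disjoint D (latticeVec v +ᵥ D)) (hCD : C ⊆ torusMk n '' D)
    {x₀ : Fin n → AddCircle (1 : ℝ)} (γ : Path x₀ x₀) (hγ : Set.range γ ⊆ C) :
    γ.Homotopic (Path.refl x₀) := by
  obtain ⟨d, hd, hdx⟩ := hCD (hγ ⟨0, γ.source⟩)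
  obtain ⟨b, hb, Γ, hΓ, hhom⟩ := (isCoveringMap_torusMk n).homotopic_of_lifts_joined hdx γ
  have hlf : LocallyFinite fun i : Unit × (Fin n → ℤ) ↦ latticeVec i.2 +ᵥ D :=
    locallyFinite_latticeVec_vadd (D := fun _ ↦ D) fun _ ↦ hD.isBounded
  have hclosed : IsClosed (⋃ v : {v : Fin n → ℤ // v ≠ 0}, latticeVec v.1 +ᵥ D) :=
    (hlf.comp_injective (g := fun v : {v : Fin n → ℤ // v ≠ 0} ↦ ((), v.1))
      fun v w h ↦ Subtype.ext (Prod.ext_iff.1 h).2).isClosed_iUnion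
      fun v ↦ (hD.vadd (latticeVec v.1)).isClosed
  have hcov : Set.range Γ ⊆ D ∪ ⋃ v : {v : Fin n → ℤ // v ≠ 0}, latticeVec v.1 +ᵥ D := by
    rintro _ ⟨t, rfl⟩
    obtain ⟨e, he, het⟩ := hCD (hγ ⟨t, rfl⟩)
    obtain ⟨v, hv⟩ := exists_latticeVec_of_torusMk_eq (het.trans (hΓ t).symm)
    by_cases hv0 : v = 0
    · left
      have : latticeVec v = 0 := by rw [hv0]; ext; simp [latticeVec]
      rw [hv, this, zero_add]
      exact he
    · exact Or.inr (Set.mem_iUnion.2 ⟨⟨v, hv0⟩, hv ▸ Set.vadd_mem_vadd_set he⟩)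
  have hdisj' : Disjoint D (⋃ v : {v : Fin n → ℤ // v ≠ 0}, latticeVec v.1 +ᵥ D) :=
    Set.disjoint_iUnion_right.2 fun v ↦ hdisj v v.2
  have hbD : b ∈ D := by
    by_contra hbD
    obtain ⟨w, -, hw, hw'⟩ := isPreconnected_closed_iff.1 (isPreconnected_range Γ.continuous) _ _
      hD.isClosed hclosed hcov ⟨d, ⟨0, Γ.source⟩, hd⟩
      ⟨b, ⟨1, Γ.target⟩, (hcov ⟨1, Γ.target⟩).resolve_left hbD⟩
    exact Set.disjoint_left.1 hdisj' hw hw'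
  obtain ⟨v, hv⟩ := exists_latticeVec_of_torusMk_eq (hdx.trans hb.symm)
  have hv0 : v = 0 := by
    by_contra hv0
    exact Set.disjoint_left.1 (hdisj v hv0) hbD (hv ▸ Set.vadd_mem_vadd_set hd)
  obtain rfl : b = d := by
    rw [hv, hv0]
    ext
    simp [latticeVec]
  refine (hhom (Path.refl b)).symm.trans ?_
  convert Path.Homotopic.refl _
  ext t
  simp [← hdx]

end Torus

/-- Let `T = ℝⁿ/ℤⁿ` (n ≥ 2) and let `C ⊆ T` be compact, connected, equal to
the closure of its interior, with connected interior, whose topological boundary is a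
finite disjoint union of images of injective continuous maps from the sphere `S^{n-1}`,
all of whose loops are null-homotopic in `T`.  Then the image of `π₁(C) → π₁(T) ≅ ℤⁿ`
induced by the inclusion is trivial or all of `ℤⁿ`: at any basepoint of `C`, either every
loop in `C` is null-homotopic in `T`, or every loop of `T` is homotopic in `T` to a loop
lying in `C`. -/
theorem component_pi1_image_trivial_or_full_of_sphere_boundaries (n : ℕ) (hn : 2 ≤ n)
    (C : Set (Fin n → AddCircle (1 : ℝ)))
    (hCcpt : IsCompact C) (hCconn : IsConnected C)
    (hCcl : C = closure (interior C)) (hCint : IsConnected (interior C))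
    (m : ℕ)
    (s : Fin m → Metric.sphere (0 : EuclideanSpace ℝ (Fin n)) 1 →
      (Fin n → AddCircle (1 : ℝ)))
    (hs_cont : ∀ k, Continuous (s k)) (hs_inj : ∀ k, Function.Injective (s k))
    (hs_disj : ∀ k l, k ≠ l → Disjoint (Set.range (s k)) (Set.range (s l)))
    (hbd : frontier C = ⋃ k, Set.range (s k))
    (hnull : ∀ (x : Fin n → AddCircle (1 : ℝ)) (γ : Path x x),
      Set.range γ ⊆ frontier C → γ.Homotopic (Path.refl x)) :
    ∀ x₀ ∈ C,
      (∀ γ : Path x₀ x₀, Set.range γ ⊆ C → γ.Homotopic (Path.refl x₀)) ∨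
      (∀ δ : Path x₀ x₀, ∃ γ : Path x₀ x₀, Set.range γ ⊆ C ∧ γ.Homotopic δ) := by
  intro x₀ hx₀
  have hrank : 1 < Module.rank ℝ (Fin n → ℝ) := by
    rw [rank_fin_fun]
    exact_mod_cast hn
  have : Fact (Module.finrank ℝ (EuclideanSpace ℝ (Fin n)) = (n - 1) + 1) :=
    ⟨by rw [finrank_euclideanSpace_fin]; omega⟩
  have : LocallyPathConnectedSpace (Metric.sphere (0 : EuclideanSpace ℝ (Fin n)) 1) :=
    ChartedSpace.locallyPathConnectedSpace (EuclideanSpace ℝ (Fin (n - 1))) _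
  have : PathConnectedSpace (Metric.sphere (0 : EuclideanSpace ℝ (Fin n)) 1) :=
    isPathConnected_iff_pathConnectedSpace.1 <| isPathConnected_sphere (by
      rw [← Module.finrank_eq_rank, finrank_euclideanSpace_fin]
      exact_mod_cast hn) 0 zero_le_one
  have hq := isOpenQuotientMap_torusMk n
  have cov := isCoveringMap_torusMk n
  have hsC (k) : Set.range (s k) ⊆ frontier C :=
    hbd ▸ Set.subset_iUnion (fun k ↦ Set.range (s k)) k
  have hlift (k : Fin m) : ∃ F : C(Metric.sphere (0 : EuclideanSpace ℝ (Fin n)) 1, Fin n → ℝ),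
      torusMk n ∘ F = s k :=
    cov.exists_lift_of_loops_nullhomotopic hq.surjective ⟨s k, hs_cont k⟩ fun a γ ↦
      hnull _ _ ((Set.range_comp_subset_range γ (s k)).trans (hsC k))
  choose F hF using hlift
  have hFs (k a) : torusMk n (F k a) = s k a := congrFun (hF k) a
  let S : Fin m × (Fin n → ℤ) → Set (Fin n → ℝ) := fun i ↦ latticeVec i.2 +ᵥ Set.range (F i.1)
  let X : Set (Fin n → ℝ) := torusMk n ⁻¹' C
  have hSc (i) : IsCompact (S i) := (isCompact_range (F i.1).continuous).vadd _
  have hSp (i) : IsPathConnected (S i) :=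
    (isPathConnected_range (F i.1).continuous).image (continuous_const_vadd _)
  have hpS (i) {x} (hx : x ∈ S i) : torusMk n x ∈ Set.range (s i.1) := by
    obtain ⟨_, ⟨a, rfl⟩, rfl⟩ := hx
    exact ⟨a, by simp [hFs]⟩
  have hSdisj (i j) (hij : i ≠ j) : Disjoint (S i) (S j) := by
    rw [Set.disjoint_left]
    intro x hxi hxj
    obtain ⟨k, v⟩ := i
    obtain ⟨l, w⟩ := j
    have hkl : k = l := by
      by_contra hkl
      exact Set.disjoint_left.1 (hs_disj k l hkl) (hpS _ hxi) (hpS _ hxj)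
    subst hkl
    obtain ⟨_, ⟨a, rfl⟩, rfl⟩ := hxi
    obtain ⟨_, ⟨b, rfl⟩, hab⟩ := hxj
    simp only [vadd_eq_add] at hab
    have h1 := congrArg (torusMk n) hab
    simp only [map_add, torusMk_latticeVec, zero_add, hFs] at h1
    rw [hs_inj k h1] at hab
    exact hij (by rw [latticeVec_injective (add_right_cancel hab)])
  have hXint : interior X = torusMk n ⁻¹' interior C :=
    (hq.isOpenMap.preimage_interior_eq_interior_preimage hq.continuous C).symm
  have hXfr : frontier X = ⋃ i, S i := by
    rw [← hq.isOpenMap.preimage_frontier_eq_frontier_preimage hq.continuous C, hbd]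
    ext x
    constructor
    · intro hx
      obtain ⟨k, a, ha⟩ := Set.mem_iUnion.1 hx
      obtain ⟨v, hv⟩ := exists_latticeVec_of_torusMk_eq ((hFs k a).trans ha)
      exact Set.mem_iUnion.2 ⟨(k, v), F k a, ⟨a, rfl⟩, hv.symm⟩
    · intro hx
      obtain ⟨i, hi⟩ := Set.mem_iUnion.1 hx
      exact Set.mem_iUnion.2 ⟨i.1, hpS i hi⟩
  by_cases hint : ∀ i, Disjoint (interior X) (filledHull (S i))
  · right
    intro δ
    have hlf : LocallyFinite fun i ↦ filledHull (S i) := by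
      simp only [S, filledHull_vadd]
      exact locallyFinite_latticeVec_vadd (D := fun k ↦ filledHull (Set.range (F k)))
        fun k ↦ isBounded_filledHull hrank (isCompact_range (F k).continuous).isBounded
    have hXi : X ⊆ closure (interior X) := by
      rw [hXint, ← hq.isOpenMap.preimage_closure_eq_closure_preimage hq.continuous, ← hCcl]
    obtain ⟨a, ha⟩ := hq.surjective x₀
    obtain ⟨b, hb, -, -, hhom⟩ := cov.homotopic_of_lifts_joined ha δ
    obtain ⟨Γ, hΓ⟩ := joinedIn_of_disjoint_filledHull hrank
      (hCcpt.isClosed.preimage hq.continuous) hXi hXfr hSc hSp hSdisj hlf hint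
      (x := a) (y := b) (by simpa [X, ha] using hx₀) (by simpa [X, hb] using hx₀)
    refine ⟨_, ?_, hhom Γ⟩
    rintro _ ⟨t, rfl⟩
    exact hΓ t
  · left
    push Not at hint
    obtain ⟨i, hi⟩ := hint
    obtain ⟨y, hyX, hyD⟩ := Set.not_disjoint_iff.1 hi
    rw [hXint] at hyX
    have hDc : IsCompact (filledHull (S i)) := Metric.isCompact_of_isClosed_isBounded
      (isClosed_filledHull (hSc i).isClosed) (isBounded_filledHull hrank (hSc i).isBounded)
    have hcov {x} (hx : x ∈ interior C) (hxD : x ∈ torusMk n '' filledHull (S i)) :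
        x ∈ torusMk n '' (filledHull (S i) \ S i) := by
      obtain ⟨d, hd, rfl⟩ := hxD
      exact ⟨d, ⟨hd, fun hdS ↦ (hsC i.1 (hpS i hdS)).2 hx⟩, rfl⟩
    have hsub : interior C ⊆ torusMk n '' filledHull (S i) := by
      by_contra hc
      obtain ⟨x, hx, hxD⟩ := Set.not_subset.1 hc
      obtain ⟨w, -, hw, hw'⟩ := hCint.isPreconnected _ _
        (hq.isOpenMap _ (isOpen_filledHull_diff (hSc i).isClosed))
        (hDc.image hq.continuous).isClosed.isOpen_compl
        (fun x hx ↦ (em (x ∈ torusMk n '' filledHull (S i))).imp_left (hcov hx))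
        ⟨_, hyX, hcov hyX ⟨y, hyD, rfl⟩⟩ ⟨x, hx, hxD⟩
      exact hw' (Set.image_mono Set.sdiff_subset hw)
    have hCD : C ⊆ torusMk n '' filledHull (S i) := by
      rw [hCcl]
      exact closure_minimal hsub (hDc.image hq.continuous).isClosed
    refine fun γ hγ ↦ homotopic_refl_of_subset_image hDc (fun v hv ↦ ?_) hCD γ hγ
    refine disjoint_vadd_filledHull hrank (hSc i) (hSp i).isConnected.isPreconnected
      (hSp i).nonempty (fun h ↦ hv (latticeVec_injective (h.trans ?_))) ?_
    · ext
      simp [latticeVec]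
    · have hS' : latticeVec v +ᵥ S i = S (i.1, v + i.2) := by
        have : latticeVec (v + i.2) = latticeVec v + latticeVec i.2 := by
          ext
          simp [latticeVec]
        simp only [S, this, add_vadd]
      rw [hS']
      refine hSdisj _ _ fun h ↦ hv ?_
      simpa using congrArg Prod.snd h
end

section
/- Let n ≥ 2 and let p : ℝ^n → ℝ^n/ℤ^n be the quotient map. Let s : S^{n−1} → ℝ^n be a continuous injective map such that p ∘ s : S^{n−1} → ℝ^n/ℤ^n is also injective, and let U be a bounded connected component of ℝ^n \ s(S^{n−1}). Then p is injective on the closure of U; equivalently, for every nonzero a ∈ ℤ^n, the closure of U is disjoint from its translate by a. -/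
open Pointwise

/-- A preconnected set avoiding `K` that meets a component of `Kᶜ` lies in that component. -/
theorem subset_connectedComponentIn_of_inter_nonempty {X : Type*}
    [TopologicalSpace X] {F C : Set X} {x : X} (hC : IsPreconnected C) (hCF : C ⊆ F)
    (h : (C ∩ connectedComponentIn F x).Nonempty) : C ⊆ connectedComponentIn F x := by
  obtain ⟨y, hyC, hyU⟩ := h
  rw [connectedComponentIn_eq hyU]
  exact hC.subset_connectedComponentIn hyC hCF

theorem closure_connectedComponentIn_inter_subset {X : Type*} [TopologicalSpace X]
    {F : Set X} {x : X} (hx : x ∈ F) :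
    closure (connectedComponentIn F x) ∩ F ⊆ connectedComponentIn F x := by
  rintro z ⟨hz, hzF⟩
  have hpre : IsPreconnected (insert z (connectedComponentIn F x)) :=
    isPreconnected_connectedComponentIn.subset_closure (Set.subset_insert _ _)
      (Set.insert_subset hz subset_closure)
  exact subset_connectedComponentIn_of_inter_nonempty hpre
    (Set.insert_subset hzF (connectedComponentIn_subset F x))
    ⟨x, Set.mem_insert_of_mem _ (mem_connectedComponentIn hx), mem_connectedComponentIn hx⟩
    (Set.mem_insert _ _)

/-- A bounded open nonempty set has a closure point outside the set which is extremal in a given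
nonzero direction. -/
theorem exists_mem_closure_diff_forall_inner_le {E : Type*} [NormedAddCommGroup E]
    [InnerProductSpace ℝ E] [ProperSpace E] {U : Set E} (hUo : IsOpen U) (hUn : U.Nonempty)
    (hUb : Bornology.IsBounded U) {a : E} (ha : a ≠ 0) :
    ∃ m ∈ closure U \ U, ∀ y ∈ closure U, inner ℝ a y ≤ inner ℝ a m := by
  have hcont : Continuous fun y : E => inner ℝ a y := by fun_prop
  obtain ⟨m, hm, hmax⟩ := hUb.isCompact_closure.exists_isMaxOn hUn.closure hcont.continuousOn
  refine ⟨m, ⟨hm, fun hmU => ?_⟩, hmax⟩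
  have hlim : Filter.Tendsto (fun t : ℝ => m + t • a) (nhdsWithin 0 (Set.Ioi 0)) (nhds m) := by
    have h : Continuous fun t : ℝ => m + t • a := by fun_prop
    simpa using (h.tendsto 0).mono_left nhdsWithin_le_nhds
  obtain ⟨t, htU, ht⟩ :=
    ((hlim.eventually (hUo.mem_nhds hmU)).and self_mem_nhdsWithin).exists
  have hle : inner ℝ a (m + t • a) ≤ inner ℝ a m := hmax (subset_closure htU)
  rw [inner_add_right, inner_smul_right] at hle
  have hpos : 0 < t * inner ℝ a a := mul_pos ht (real_inner_self_pos.2 ha)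
  linarith

/-- If a closed connected set `K` is disjoint from its translate by `a`, then so is the closure of
each bounded component of its complement. -/
theorem add_notMem_closure_connectedComponentIn_compl {E : Type*} [NormedAddCommGroup E]
    [InnerProductSpace ℝ E] [ProperSpace E] {K : Set E} (hKc : IsClosed K)
    (hK : IsPreconnected K) {x : E} (hx : x ∈ Kᶜ)
    (hb : Bornology.IsBounded (connectedComponentIn Kᶜ x)) {a : E} (ha : a ≠ 0)
    (hKa : ∀ y ∈ K, y + a ∉ K) {y : E} (hy : y ∈ closure (connectedComponentIn Kᶜ x)) :
    y + a ∉ closure (connectedComponentIn Kᶜ x) := by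
  set U := connectedComponentIn Kᶜ x with hU
  have hsub : closure U ∩ Kᶜ ⊆ U := closure_connectedComponentIn_inter_subset hx
  have extremal : ∀ b : E, b ≠ 0 → ∃ m ∈ closure U \ U, m + b ∉ closure U := by
    intro b hb0
    obtain ⟨m, hm, hmax⟩ := exists_mem_closure_diff_forall_inner_le
      hKc.isOpen_compl.connectedComponentIn ⟨x, mem_connectedComponentIn hx⟩ hb hb0
    refine ⟨m, hm, fun h => ?_⟩
    have hle := hmax _ h
    rw [inner_add_right] at hle
    have hpos := real_inner_self_pos.2 hb0
    linarith
  have translate : ∀ b : E, b ≠ 0 → (∀ z ∈ K, z + b ∉ K) → ∀ z ∈ K, z + b ∉ closure U := by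
    intro b hb0 hKb z hz hzU
    obtain ⟨m, hm, hmb⟩ := extremal b hb0
    have hmK : m ∈ K := by_contra fun h => hm.2 (hsub ⟨hm.1, h⟩)
    have himg : (fun w => w + b) '' K ⊆ U :=
      subset_connectedComponentIn_of_inter_nonempty
        (hK.image _ (continuous_add_const b).continuousOn)
        (Set.image_subset_iff.2 hKb) ⟨z + b, ⟨z, hz, rfl⟩, hsub ⟨hzU, hKb z hz⟩⟩
    exact hmb (subset_closure (himg ⟨m, hmK, rfl⟩))
  intro hya
  have hdisj : ∀ z ∈ closure U, z + a ∉ K := fun z hz hzK =>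
    translate (-a) (neg_ne_zero.2 ha)
      (fun w hw hwK => hKa _ hwK (by simpa using hw)) _ hzK (by simpa using hz)
  have himg : (fun w => w + a) '' closure U ⊆ U :=
    subset_connectedComponentIn_of_inter_nonempty
      (isPreconnected_connectedComponentIn.closure.image _ (continuous_add_const a).continuousOn)
      (Set.image_subset_iff.2 hdisj) ⟨y + a, ⟨y, hy, rfl⟩, hsub ⟨hya, hdisj y hy⟩⟩
  obtain ⟨m, hm, hma⟩ := extremal a ha
  exact hma (subset_closure (himg ⟨m, hm.1, rfl⟩))

/-- Let `p : ℝⁿ → ℝⁿ/ℤⁿ` be the quotient map (n ≥ 2), let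
`s : S^{n-1} → ℝⁿ` be continuous and injective with `p ∘ s` injective, and let `U` be a
bounded connected component of `ℝⁿ \ s(S^{n-1})`.  Then `p` is injective on the closure
of `U`. -/
theorem quotient_injective_on_closure_of_bounded_component (n : ℕ) (hn : 2 ≤ n)
    (s : Metric.sphere (0 : EuclideanSpace ℝ (Fin n)) 1 → EuclideanSpace ℝ (Fin n))
    (hs_cont : Continuous s) (hs_inj : Function.Injective s)
    (hps_inj : Function.Injective
      (fun v => (fun i => ((s v i : ℝ) : AddCircle (1 : ℝ)))))
    (U : Set (EuclideanSpace ℝ (Fin n)))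
    (hU : ∃ x ∈ (Set.range s)ᶜ, U = connectedComponentIn (Set.range s)ᶜ x)
    (hUbdd : Bornology.IsBounded U) :
    Set.InjOn (fun x : EuclideanSpace ℝ (Fin n) =>
      (fun i => ((x i : ℝ) : AddCircle (1 : ℝ)))) (closure U) := by
  obtain ⟨x, hx, rfl⟩ := hU
  have hrank : 1 < Module.rank ℝ (EuclideanSpace ℝ (Fin n)) := by
    rw [← Module.finrank_eq_rank, finrank_euclideanSpace_fin]
    exact_mod_cast hn
  have : PreconnectedSpace (Metric.sphere (0 : EuclideanSpace ℝ (Fin n)) 1) :=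
    Subtype.preconnectedSpace (isPreconnected_sphere hrank 0 1)
  intro y hy z hz hyz
  by_contra hne
  have ha : z - y ≠ 0 := sub_ne_zero.2 (Ne.symm hne)
  refine add_notMem_closure_connectedComponentIn_compl (isCompact_range hs_cont).isClosed
    (isPreconnected_range hs_cont) hx hUbdd ha ?_ hy (by simpa using hz)
  rintro _ ⟨v, rfl⟩ ⟨w, hw⟩
  have hvw : w = v := by
    refine hps_inj (funext fun i => ?_)
    have hi : ((y i : ℝ) : AddCircle (1 : ℝ)) = (z i : ℝ) := congrFun hyz i
    simp [hw, hi]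
  subst hvw
  exact ha (by simpa using hw)
end

section
/- Let n ≥ 1, let T = ℝ^n/ℤ^n with quotient map p : ℝ^n → T, and let A ⊆ ℝ^n be a compact set such that p restricted to A is injective. Then every loop contained in p(A) is null-homotopic in T, i.e. the inclusion p(A) → T induces the trivial map on fundamental groups. -/
open Pointwise

/-- Let `p : ℝⁿ → T = ℝⁿ/ℤⁿ` be the quotient map (n ≥ 1) and let
`A ⊆ ℝⁿ` be compact with `p` injective on `A`.  Then every loop contained in `p(A)` is
null-homotopic in `T`. -/
theorem loops_in_injective_image_nullhomotopic (n : ℕ) (hn : 1 ≤ n)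
    (A : Set (Fin n → ℝ)) (hA : IsCompact A)
    (hinj : Set.InjOn
      (fun x : Fin n → ℝ => (fun i => ((x i : ℝ) : AddCircle (1 : ℝ)))) A) :
    ∀ (x : Fin n → AddCircle (1 : ℝ)) (γ : Path x x),
      Set.range γ ⊆
        (fun x : Fin n → ℝ => (fun i => ((x i : ℝ) : AddCircle (1 : ℝ)))) '' A →
      γ.Homotopic (Path.refl x) := by
  intro x γ hγ
  set p : (Fin n → ℝ) → Fin n → AddCircle (1 : ℝ) := fun x i => ((x i : ℝ) : AddCircle (1 : ℝ))
  have hp : Continuous p :=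
    continuous_pi fun i => (AddCircle.continuous_mk' (1 : ℝ)).comp (continuous_apply i)
  have : CompactSpace A := isCompact_iff_compactSpace.mp hA
  have hemb : Topology.IsClosedEmbedding (A.domRestrict p) :=
    (hp.comp continuous_subtype_val).isClosedEmbedding hinj.injective
  choose g hgA hg using fun t => hγ (Set.mem_range_self t)
  have hgc : Continuous fun t => (⟨g t, hgA t⟩ : A) := by
    rw [hemb.isInducing.continuous_iff]
    exact γ.continuous.congr fun t => (hg t).symm
  have hloop : g 1 = g 0 := hinj (hgA 1) (hgA 0) (by rw [hg, hg]; simp)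
  let δ : Path (g 0) (g 0) := ⟨⟨g, continuous_subtype_val.comp hgc⟩, rfl, hloop⟩
  have hδ := (SimplyConnectedSpace.paths_homotopic δ (Path.refl (g 0))).map ⟨p, hp⟩
  obtain rfl : p (g 0) = x := by rw [hg]; simp
  have hγδ : γ = δ.map hp := Path.ext (funext fun t => (hg t).symm)
  rw [hγδ]
  exact hδ
end
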